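/- Let Φ be an integral domain. The representation of a tame automorphism φ of L_3(Φ) in the form φ = σ_1 ∘ τ_1 ∘ σ_2 ∘ τ_2 ∘ ⋯ ∘ σ_k ∘ τ_k ∘ λ (with σ_i ∈ A_0, σ_2,…,σ_k ≠ id, τ_i ∈ B_0, τ_1,…,τ_k ≠ id, λ ∈ GL_3(Φ)) is unique; equivalently, no product σ_1 ∘ τ_1 ∘ σ_2 ∘ τ_2 ∘ ⋯ ∘ σ_k ∘ τ_k ∘ σ_{k+1} ∘ λ with k ≥ 1, σ_i ∈ A_0, σ_2,…,σ_k ≠ id, τ_i ∈ B_0, τ_1,…,τ_k ≠ id, λ ∈ GL_3(Φ) equals the identity automorphism. -/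

import Mathlib

/-- The group structure (under composition) on the Lie algebra automorphisms. -/
noncomputable instance lieAutGroup (Φ : Type*) [CommRing Φ] (L : Type*)
    [LieRing L] [LieAlgebra Φ L] : Group (L ≃ₗ⁅Φ⁆ L) where
  mul e f := f.trans e
  one := LieEquiv.refl
  inv := LieEquiv.symm
  mul_assoc e f g := rfl
  one_mul e := rfl
  mul_one e := rfl
  inv_mul_cancel e := LieEquiv.ext fun x => e.symm_apply_apply x

/-- The free generators `x_1, x_2, x_3` of `L_3(Φ) = L_Φ⟨x_1,x_2,x_3⟩`. -/
noncomputable def xg (Φ : Type*) [CommRing Φ] (i : Fin 3) :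
    FreeLieAlgebra Φ (Fin 3) :=
  FreeLieAlgebra.of Φ i

/-- A linear automorphism of `L_3(Φ)`: each generator is sent to a `Φ`-linear
combination of the generators (membership in `GL_3(Φ)`). -/
def IsLinearAut (Φ : Type*) [CommRing Φ]
    (φ : FreeLieAlgebra Φ (Fin 3) ≃ₗ⁅Φ⁆ FreeLieAlgebra Φ (Fin 3)) : Prop :=
  ∀ i : Fin 3, φ (xg Φ i) ∈ Submodule.span Φ (Set.range (xg Φ))

/-- A triangular automorphism of `L_3(Φ)` (membership in `B_3(Φ)`):
`μ = (α₁x₁ + h(x₂,x₃), β₂x₂ + β₃x₃, γ₂x₂ + γ₃x₃)` with `α₁` and `β₂γ₃ - β₃γ₂`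
units of `Φ` and `h` in the subalgebra generated by `x₂, x₃`. -/
def IsTriangularAut (Φ : Type*) [CommRing Φ]
    (φ : FreeLieAlgebra Φ (Fin 3) ≃ₗ⁅Φ⁆ FreeLieAlgebra Φ (Fin 3)) : Prop :=
  ∃ (α₁ β₂ β₃ γ₂ γ₃ : Φ) (h : FreeLieAlgebra Φ (Fin 3)),
    IsUnit α₁ ∧ IsUnit (β₂ * γ₃ - β₃ * γ₂) ∧
    h ∈ LieSubalgebra.lieSpan Φ (FreeLieAlgebra Φ (Fin 3)) {xg Φ 1, xg Φ 2} ∧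
    φ (xg Φ 0) = α₁ • xg Φ 0 + h ∧
    φ (xg Φ 1) = β₂ • xg Φ 1 + β₃ • xg Φ 2 ∧
    φ (xg Φ 2) = γ₂ • xg Φ 1 + γ₃ • xg Φ 2

/-- Membership in the set `B₀ = {τ = (x₁ + h(x₂,x₃), x₂, x₃) : h ∈ [L₃(Φ),L₃(Φ)]}`. -/
def IsB0Aut (Φ : Type*) [CommRing Φ]
    (τ : FreeLieAlgebra Φ (Fin 3) ≃ₗ⁅Φ⁆ FreeLieAlgebra Φ (Fin 3)) : Prop :=
  ∃ h : FreeLieAlgebra Φ (Fin 3),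
    h ∈ LieSubalgebra.lieSpan Φ (FreeLieAlgebra Φ (Fin 3)) {xg Φ 1, xg Φ 2} ∧
    h ∈ LieAlgebra.derivedSeries Φ (FreeLieAlgebra Φ (Fin 3)) 1 ∧
    τ (xg Φ 0) = xg Φ 0 + h ∧ τ (xg Φ 1) = xg Φ 1 ∧ τ (xg Φ 2) = xg Φ 2

/-- An elementary automorphism of `L_3(Φ)`: for some `i`, it sends `x_i` to
`α • x_i + f` with `α` a unit of `Φ` and `f` in the subalgebra generated by the
other two generators, and fixes the other generators. -/
def IsElementaryAut (Φ : Type*) [CommRing Φ]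
    (φ : FreeLieAlgebra Φ (Fin 3) ≃ₗ⁅Φ⁆ FreeLieAlgebra Φ (Fin 3)) : Prop :=
  ∃ (i : Fin 3) (α : Φ) (f : FreeLieAlgebra Φ (Fin 3)), IsUnit α ∧
    f ∈ LieSubalgebra.lieSpan Φ (FreeLieAlgebra Φ (Fin 3)) (xg Φ '' {j | j ≠ i}) ∧
    φ (xg Φ i) = α • xg Φ i + f ∧ ∀ j : Fin 3, j ≠ i → φ (xg Φ j) = xg Φ j

/-- A tame automorphism of `L_3(Φ)`: an element of the subgroup generated by the
elementary automorphisms. -/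
def IsTameAut (Φ : Type*) [CommRing Φ]
    (φ : FreeLieAlgebra Φ (Fin 3) ≃ₗ⁅Φ⁆ FreeLieAlgebra Φ (Fin 3)) : Prop :=
  φ ∈ Subgroup.closure {ψ | IsElementaryAut Φ ψ}

/-- `A₀` is a system of representatives, containing the identity, of the left cosets
of `H(Φ) = GL₃(Φ) ∩ B₃(Φ)` in `GL₃(Φ)`. -/
def IsA0System (Φ : Type*) [CommRing Φ]
    (A0 : Set (FreeLieAlgebra Φ (Fin 3) ≃ₗ⁅Φ⁆ FreeLieAlgebra Φ (Fin 3))) : Prop :=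
  (1 ∈ A0) ∧ (∀ a ∈ A0, IsLinearAut Φ a) ∧
  (∀ σ, IsLinearAut Φ σ → ∃ a ∈ A0,
    IsLinearAut Φ (a⁻¹ * σ) ∧ IsTriangularAut Φ (a⁻¹ * σ)) ∧
  (∀ a ∈ A0, ∀ a' ∈ A0, a ≠ a' →
    ¬ (IsLinearAut Φ (a⁻¹ * a') ∧ IsTriangularAut Φ (a⁻¹ * a')))

open MonoidAlgebra

/-- The free associative algebra on `X`, realised on the basis of words. -/
abbrev FreeAssoc (R X : Type*) [CommRing R] := MonoidAlgebra R (FreeMonoid X)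

namespace FreeAssoc

variable {R X B : Type*} [CommRing R] [Ring B] [Algebra R B]

/-- The generator of the free associative algebra attached to a letter. -/
noncomputable def letter (R : Type*) {X : Type*} [CommRing R] (x : X) : FreeAssoc R X :=
  single (FreeMonoid.of x) 1

/-- Substitution of elements of an algebra for the letters. -/
noncomputable def eval (φ : X → B) : FreeAssoc R X →ₐ[R] B :=
  MonoidAlgebra.lift R B (FreeMonoid X) (FreeMonoid.lift φ)

@[simp]
theorem eval_letter (φ : X → B) (x : X) : eval φ (letter R x) = φ x := by
  simp [eval, letter]

theorem eval_single (φ : X → B) (m : FreeMonoid X) (c : R) :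
    eval φ (single m c) = c • FreeMonoid.lift φ m := by
  simp [eval]

theorem algHom_ext {F G : FreeAssoc R X →ₐ[R] B} (h : ∀ x, F (letter R x) = G (letter R x)) :
    F = G :=
  MonoidAlgebra.algHom_ext' (FreeMonoid.hom_eq h) (by ext)

theorem eval_comp {C : Type*} [Ring C] [Algebra R C] (F : B →ₐ[R] C) (φ : X → B)
    (p : FreeAssoc R X) : F (eval φ p) = eval (fun x => F (φ x)) p :=
  DFunLike.congr_fun (algHom_ext (F := F.comp (eval φ)) (by simp)) p

theorem eval_letter_self (p : FreeAssoc R X) : eval (letter R) p = p :=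
  DFunLike.congr_fun (algHom_ext (G := AlgHom.id R (FreeAssoc R X)) (by simp)) p

theorem single_of_mul (x : X) (m : FreeMonoid X) (c : R) :
    single (FreeMonoid.of x * m) c = letter R x * single m c := by
  simp [letter]

/-- The shift derivation on words: the sum over the positions of a word of the word in which
the letter `z` at that position is replaced by `s z`. -/
noncomputable def shiftWord (R : Type*) [CommRing R] {Z : Type*} (s : Z → Z) :
    List Z → FreeAssoc R Z
  | [] => 0
  | z :: m => letter R (s z) * single (FreeMonoid.ofList m) 1 + letter R z * shiftWord R s m

/-- The derivation of the free associative algebra which maps each letter `z` to `s z`. -/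
noncomputable def shift {Z : Type*} (s : Z → Z) : FreeAssoc R Z →ₗ[R] FreeAssoc R Z :=
  Finsupp.linearCombination R (fun m : FreeMonoid Z => shiftWord R s m.toList) ∘ₗ
    (coeffLinearEquiv R).toLinearMap

theorem shift_single {Z : Type*} (s : Z → Z) (m : FreeMonoid Z) (c : R) :
    shift s (single m c) = c • shiftWord R s m.toList := by
  simp [shift]

theorem shift_one {Z : Type*} (s : Z → Z) : shift s (1 : FreeAssoc R Z) = 0 := by
  rw [one_def, shift_single]
  simp [shiftWord]

theorem shift_letter_mul {Z : Type*} (s : Z → Z) (z : Z) (a : FreeAssoc R Z) :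
    shift s (letter R z * a) = letter R (s z) * a + letter R z * shift s a := by
  induction a using MonoidAlgebra.induction_linear with
  | zero => simp
  | add a b ha hb => rw [mul_add, map_add, ha, hb, map_add]; noncomm_ring
  | single m c =>
    rw [← single_of_mul, shift_single, shift_single, FreeMonoid.toList_of_mul, shiftWord,
      smul_add, mul_smul_comm, ← mul_smul_comm, smul_single]
    simp

end FreeAssoc

section ToAssoc

attribute [local instance] LieRing.ofAssociativeRing

open FreeAssoc

variable {R X : Type*} [CommRing R]

/-- The canonical map from the free Lie algebra to the free associative algebra. -/
noncomputable def FreeLieAlgebra.toAssoc (R X : Type*) [CommRing R] :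
    FreeLieAlgebra R X →ₗ⁅R⁆ FreeAssoc R X :=
  FreeLieAlgebra.lift R (letter R)

namespace FreeLieAlgebra

@[simp]
theorem toAssoc_of (x : X) : toAssoc R X (of R x) = letter R x := by
  simp [toAssoc]

/-- Lie monomials of a given length with letters in a given set. -/
inductive IsLieMonomial (R : Type*) {X : Type*} [CommRing R] (S : Set X) :
    ℕ → FreeLieAlgebra R X → Prop
  | of {x : X} (hx : x ∈ S) : IsLieMonomial R S 1 (of R x)
  | lie {a b : ℕ} {u v : FreeLieAlgebra R X} (hu : IsLieMonomial R S a u)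
      (hv : IsLieMonomial R S b v) : IsLieMonomial R S (a + b) ⁅u, v⁆

theorem IsLieMonomial.pos {S : Set X} {n : ℕ} {u : FreeLieAlgebra R X}
    (h : IsLieMonomial R S n u) : 0 < n := by
  induction h with
  | of => exact one_pos
  | lie _ _ ha _ => omega

theorem IsLieMonomial.mono {S T : Set X} (hST : S ⊆ T) {n : ℕ} {u : FreeLieAlgebra R X}
    (h : IsLieMonomial R S n u) : IsLieMonomial R T n u := by
  induction h with
  | of hx => exact .of (hST hx)
  | lie _ _ hu hv => exact .lie hu hv

/-- The span of the Lie monomials of length `n` with letters in `S`. -/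
noncomputable def lieHom (R : Type*) {X : Type*} [CommRing R] (S : Set X) (n : ℕ) :
    Submodule R (FreeLieAlgebra R X) :=
  Submodule.span R {u | IsLieMonomial R S n u}

/-- The span of the Lie monomials of length less than `n`. -/
noncomputable def lieLT (R X : Type*) [CommRing R] (n : ℕ) : Submodule R (FreeLieAlgebra R X) :=
  Submodule.span R {u | ∃ k < n, IsLieMonomial R Set.univ k u}

theorem lieLT_mono {m n : ℕ} (h : m ≤ n) : lieLT R X m ≤ lieLT R X n :=
  Submodule.span_mono fun _ ⟨k, hk, hu⟩ => ⟨k, hk.trans_le h, hu⟩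

theorem lieHom_le_lieLT {S : Set X} {m n : ℕ} (h : m < n) : lieHom R S m ≤ lieLT R X n :=
  Submodule.span_mono fun _ hu => ⟨m, h, hu.mono (Set.subset_univ S)⟩

theorem lie_mem_of_mem_span {A B : Set (FreeLieAlgebra R X)}
    {C : Submodule R (FreeLieAlgebra R X)} (h : ∀ u ∈ A, ∀ v ∈ B, ⁅u, v⁆ ∈ C)
    {u v : FreeLieAlgebra R X} (hu : u ∈ Submodule.span R A) (hv : v ∈ Submodule.span R B) :
    ⁅u, v⁆ ∈ C := by
  induction hu, hv using Submodule.span_induction₂ with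
  | mem_mem x y hx hy => exact h x hx y hy
  | zero_left y _ => simp
  | zero_right x _ => simp
  | add_left x y z _ _ _ h1 h2 => rw [add_lie]; exact C.add_mem h1 h2
  | add_right x y z _ _ _ h1 h2 => rw [lie_add]; exact C.add_mem h1 h2
  | smul_left r x y _ _ h => rw [smul_lie]; exact C.smul_mem r h
  | smul_right r x y _ _ h => rw [lie_smul]; exact C.smul_mem r h

theorem lie_mem_lieHom {S : Set X} {a b : ℕ} {u v : FreeLieAlgebra R X}
    (hu : u ∈ lieHom R S a) (hv : v ∈ lieHom R S b) : ⁅u, v⁆ ∈ lieHom R S (a + b) :=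
  lie_mem_of_mem_span (fun _ h1 _ h2 => Submodule.subset_span (.lie h1 h2)) hu hv

theorem lie_mem_lieLT {a b c : ℕ} (h : a + b ≤ c + 1) {u v : FreeLieAlgebra R X}
    (hu : u ∈ lieLT R X a) (hv : v ∈ lieLT R X b) : ⁅u, v⁆ ∈ lieLT R X c :=
  lie_mem_of_mem_span (by
    rintro _ ⟨k, hk, h1⟩ _ ⟨l, hl, h2⟩
    exact Submodule.subset_span ⟨k + l, by omega, .lie h1 h2⟩) hu hv

/-- Lazard elimination of the letter `x`: the map from the free Lie algebra on the letters
`(y, n)`, with `y ≠ x` and `n : ℕ`, which sends `(y, n)` to `(ad x)ⁿ y`. -/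
noncomputable def elim (R : Type*) {X : Type*} [CommRing R] (x : X) :
    FreeLieAlgebra R ({y // y ≠ x} × ℕ) →ₗ⁅R⁆ FreeLieAlgebra R X :=
  FreeLieAlgebra.lift R fun z => ((LieAlgebra.ad R _ (of R x)) ^ z.2) (of R z.1.1)

theorem elim_of_zero {x y : X} (hy : y ≠ x) : elim R x (of R (⟨y, hy⟩, 0)) = of R y := by
  simp [elim]

theorem lie_elim_of (x : X) (y : {y // y ≠ x}) (n : ℕ) :
    ⁅of R x, elim R x (of R (y, n))⁆ = elim R x (of R (y, n + 1)) := by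
  simp [elim, pow_succ']

theorem exists_lie_elim_of_isLieMonomial (x : X) {k : ℕ}
    {v : FreeLieAlgebra R ({y // y ≠ x} × ℕ)} (hv : IsLieMonomial R Set.univ k v) :
    ∃ v' ∈ lieHom R Set.univ k, ⁅of R x, elim R x v⁆ = elim R x v' := by
  induction hv with
  | @of z _ =>
    exact ⟨of R (z.1, z.2 + 1), Submodule.subset_span (.of trivial), lie_elim_of x z.1 z.2⟩
  | @lie a b u v hu hv ihu ihv =>
    obtain ⟨u', hu', eu⟩ := ihu
    obtain ⟨v', hv', ev⟩ := ihv
    refine ⟨⁅u', v⁆ + ⁅u, v'⁆, add_mem (lie_mem_lieHom hu' (Submodule.subset_span hv))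
      (lie_mem_lieHom (Submodule.subset_span hu) hv'), ?_⟩
    rw [LieHom.map_lie, leibniz_lie, eu, ev, map_add, LieHom.map_lie, LieHom.map_lie]

theorem exists_lie_elim (x : X) {k : ℕ} {v : FreeLieAlgebra R ({y // y ≠ x} × ℕ)}
    (hv : v ∈ lieLT R _ k) : ∃ v' ∈ lieLT R _ k, ⁅of R x, elim R x v⁆ = elim R x v' := by
  induction hv using Submodule.span_induction with
  | mem u hu =>
    obtain ⟨l, hl, hu⟩ := hu
    obtain ⟨v', hv', e⟩ := exists_lie_elim_of_isLieMonomial x hu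
    exact ⟨v', lieHom_le_lieLT hl hv', e⟩
  | zero => exact ⟨0, zero_mem _, by simp⟩
  | add u v _ _ hu hv =>
    obtain ⟨u', hu', eu⟩ := hu
    obtain ⟨v', hv', ev⟩ := hv
    exact ⟨u' + v', add_mem hu' hv', by simp [eu, ev]⟩
  | smul r u _ hu =>
    obtain ⟨u', hu', eu⟩ := hu
    exact ⟨r • u', Submodule.smul_mem _ r hu', by simp [eu]⟩

/-- The letters `(y, 0)` with `y ∈ S`. -/
def elimSet (x : X) (S : Set X) : Set ({y // y ≠ x} × ℕ) :=
  {z | z.1.1 ∈ S ∧ z.2 = 0}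

theorem exists_eq_elim_of_isLieMonomial (x : X) {S : Set X} {k : ℕ} {u : FreeLieAlgebra R X}
    (hu : IsLieMonomial R S k u) :
    (k = 1 ∧ u = of R x) ∨
      ∃ v ∈ lieHom R (elimSet x S) k ⊔ lieLT R ({y // y ≠ x} × ℕ) k, u = elim R x v := by
  induction hu with
  | @of y hy =>
    by_cases hyx : y = x
    · exact .inl ⟨rfl, by rw [hyx]⟩
    · exact .inr ⟨of R (⟨y, hyx⟩, 0), Submodule.mem_sup_left (Submodule.subset_span
        (.of ⟨hy, rfl⟩)), (elim_of_zero hyx).symm⟩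
  | @lie a b u v hu hv ihu ihv =>
    right
    have key : ∀ (c : ℕ), lieHom R (elimSet x S) c ⊔ lieLT R ({y // y ≠ x} × ℕ) c ≤
        lieLT R ({y // y ≠ x} × ℕ) (c + 1) := fun c =>
      sup_le (lieHom_le_lieLT (Nat.lt_succ_self c)) (lieLT_mono (Nat.le_succ c))
    rcases ihu with ⟨rfl, rfl⟩ | ⟨u', hu', rfl⟩
    · rcases ihv with ⟨rfl, rfl⟩ | ⟨v', hv', rfl⟩
      · exact ⟨0, zero_mem _, by simp⟩
      · obtain ⟨w, hw, e⟩ := exists_lie_elim x (key _ hv')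
        exact ⟨w, Submodule.mem_sup_right (lieLT_mono (by omega) hw), e⟩
    · rcases ihv with ⟨rfl, rfl⟩ | ⟨v', hv', rfl⟩
      · obtain ⟨w, hw, e⟩ := exists_lie_elim x (key _ hu')
        exact ⟨-w, Submodule.mem_sup_right (neg_mem hw), by rw [map_neg, ← e, lie_skew]⟩
      · refine ⟨⁅u', v'⁆, ?_, by simp⟩
        obtain ⟨u₁, hu₁, u₂, hu₂, rfl⟩ := Submodule.mem_sup.1 hu'
        obtain ⟨v₁, hv₁, v₂, hv₂, rfl⟩ := Submodule.mem_sup.1 hv'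
        rw [add_lie, lie_add]
        refine add_mem (add_mem (Submodule.mem_sup_left (lie_mem_lieHom hu₁ hv₁))
          (Submodule.mem_sup_right (lie_mem_lieLT (by omega) (key _ (Submodule.mem_sup_left hu₁))
            hv₂))) (Submodule.mem_sup_right (lie_mem_lieLT (by omega) hu₂ (key _ hv')))

/-- The representation of the free associative algebra on `X` by operators on the free
associative algebra on the letters `(y, n)`, for which `x` acts by the derivation
`(y, n) ↦ (y, n + 1)` and `y ≠ x` acts as left multiplication by `(y, 0)`. -/
noncomputable def elimRep (R : Type*) {X : Type*} [CommRing R] (x : X) :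
    FreeAssoc R X →ₐ[R] Module.End R (FreeAssoc R ({y // y ≠ x} × ℕ)) :=
  open Classical in
  FreeAssoc.eval fun y => if hy : y = x then shift fun z => (z.1, z.2 + 1)
    else LinearMap.mulLeft R (letter R (⟨y, hy⟩, 0))

theorem elimRep_self (x : X) :
    elimRep R x (letter R x) = shift fun z => (z.1, z.2 + 1) := by
  simp [elimRep]

theorem elimRep_elim (x : X) (v : FreeLieAlgebra R ({y // y ≠ x} × ℕ)) :
    elimRep R x (toAssoc R X (elim R x v)) = LinearMap.mulLeft R (toAssoc R _ v) := by
  have h : ((elimRep R x : _ →ₐ[R] _) : _ →ₗ⁅R⁆ _).comp ((toAssoc R X).comp (elim R x)) =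
      (Algebra.lmul R (FreeAssoc R ({y // y ≠ x} × ℕ))).toLieHom.comp (toAssoc R _) := by
    ext1 ⟨y, n⟩
    change elimRep R x (toAssoc R X (elim R x (of R (y, n)))) =
      LinearMap.mulLeft R (toAssoc R _ (of R (y, n)))
    induction n with
    | zero =>
      obtain ⟨y, hy⟩ := y
      rw [elim_of_zero hy]
      simp [elimRep, hy]
    | succ n ih =>
      rw [← lie_elim_of, LieHom.map_lie, LieRing.of_associative_ring_bracket, map_sub, map_mul,
        map_mul, ih, toAssoc_of, elimRep_self, toAssoc_of]
      refine LinearMap.ext fun a => ?_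
      simp [shift_letter_mul]
  exact LieHom.congr_fun h v

theorem eq_zero_of_toAssoc_add {x : X} {c : R} {v : FreeLieAlgebra R ({y // y ≠ x} × ℕ)}
    (h : toAssoc R X (c • of R x + elim R x v) = 0) : toAssoc R _ v = 0 := by
  have := LinearMap.congr_fun (congrArg (elimRep R x) h) 1
  rw [map_add, map_add, elimRep_elim, map_smul, map_smul, toAssoc_of, elimRep_self] at this
  simpa [shift_one] using this

theorem exists_eq_smul_add_elim (x : X) {S : Set X} {n : ℕ} (hn : n ≠ 1) {h : FreeLieAlgebra R X}
    (hh : h ∈ lieHom R S n ⊔ lieLT R X n) :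
    ∃ (c : R), ∃ v ∈ lieHom R (elimSet x S) n ⊔ lieLT R ({y // y ≠ x} × ℕ) n,
      h = c • of R x + elim R x v := by
  rw [lieHom, lieLT, ← Submodule.span_union] at hh
  induction hh using Submodule.span_induction with
  | mem u hu =>
    rcases hu with hu | ⟨k, hk, hu⟩
    · rcases exists_eq_elim_of_isLieMonomial x hu with ⟨h1, -⟩ | ⟨v, hv, rfl⟩
      · exact absurd h1 hn
      · exact ⟨0, v, hv, by simp⟩
    · rcases exists_eq_elim_of_isLieMonomial x hu with ⟨-, rfl⟩ | ⟨v, hv, rfl⟩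
      · exact ⟨1, 0, zero_mem _, by simp⟩
      · have hle : lieHom R (elimSet x Set.univ) k ⊔ lieLT R ({y // y ≠ x} × ℕ) k ≤
            lieLT R ({y // y ≠ x} × ℕ) n := sup_le (lieHom_le_lieLT hk) (lieLT_mono hk.le)
        exact ⟨0, v, Submodule.mem_sup_right (hle hv), by simp⟩
  | zero => exact ⟨0, 0, zero_mem _, by simp⟩
  | add u v _ _ hu hv =>
    obtain ⟨c, u', hu', rfl⟩ := hu
    obtain ⟨d, v', hv', rfl⟩ := hv
    exact ⟨c + d, u' + v', add_mem hu' hv', by rw [map_add, add_smul]; abel⟩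
  | smul r u _ hu =>
    obtain ⟨c, u', hu', rfl⟩ := hu
    exact ⟨r * c, r • u', Submodule.smul_mem _ r hu', by rw [map_smul, smul_add, mul_smul]⟩

theorem IsLieMonomial.exists_finite {S : Set X} {n : ℕ} {u : FreeLieAlgebra R X}
    (h : IsLieMonomial R S n u) : ∃ T : Set X, T.Finite ∧ IsLieMonomial R T n u := by
  induction h with
  | @of x hx => exact ⟨{x}, Set.finite_singleton x, .of rfl⟩
  | lie _ _ hu hv =>
    obtain ⟨T, hT, hu⟩ := hu
    obtain ⟨T', hT', hv⟩ := hv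
    exact ⟨T ∪ T', hT.union hT', .lie (hu.mono Set.subset_union_left)
      (hv.mono Set.subset_union_right)⟩

theorem lieHom_mono {S T : Set X} (h : S ⊆ T) (n : ℕ) : lieHom R S n ≤ lieHom R T n :=
  Submodule.span_mono fun _ hu => hu.mono h

theorem exists_finite_of_mem_lieLT_succ {n : ℕ} {h : FreeLieAlgebra R X}
    (hh : h ∈ lieLT R X (n + 1)) :
    ∃ S : Set X, S.Finite ∧ h ∈ lieHom R S n ⊔ lieLT R X n := by
  induction hh using Submodule.span_induction with
  | mem u hu =>
    obtain ⟨k, hk, hu⟩ := hu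
    rcases Nat.lt_succ_iff_lt_or_eq.1 hk with hk | rfl
    · exact ⟨∅, Set.finite_empty, Submodule.mem_sup_right (Submodule.subset_span ⟨k, hk, hu⟩)⟩
    · obtain ⟨T, hT, hu⟩ := hu.exists_finite
      exact ⟨T, hT, Submodule.mem_sup_left (Submodule.subset_span hu)⟩
  | zero => exact ⟨∅, Set.finite_empty, zero_mem _⟩
  | add u v _ _ hu hv =>
    obtain ⟨S, hS, hu⟩ := hu
    obtain ⟨T, hT, hv⟩ := hv
    have hle : ∀ {A B : Set X}, A ⊆ B →
        lieHom R A n ⊔ lieLT R X n ≤ lieHom R B n ⊔ lieLT R X n :=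
      fun h => sup_le_sup_right (lieHom_mono h n) _
    exact ⟨S ∪ T, hS.union hT, add_mem (hle Set.subset_union_left hu)
      (hle Set.subset_union_right hv)⟩
  | smul r u _ hu =>
    obtain ⟨S, hS, hu⟩ := hu
    exact ⟨S, hS, Submodule.smul_mem _ r hu⟩

theorem exists_mem_lieLT (h : FreeLieAlgebra R X) : ∃ n, h ∈ lieLT R X n := by
  let K : LieSubalgebra R (FreeLieAlgebra R X) :=
    { carrier := {h | ∃ n, h ∈ lieLT R X n}
      zero_mem' := ⟨0, zero_mem _⟩
      add_mem' := fun ⟨m, hm⟩ ⟨n, hn⟩ => ⟨max m n, add_mem (lieLT_mono (le_max_left m n) hm)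
        (lieLT_mono (le_max_right m n) hn)⟩
      smul_mem' := fun r _ ⟨n, hn⟩ => ⟨n, Submodule.smul_mem _ r hn⟩
      lie_mem' := fun ⟨m, hm⟩ ⟨n, hn⟩ => ⟨m + n, lie_mem_lieLT (by omega) hm hn⟩ }
  let F : FreeLieAlgebra R X →ₗ⁅R⁆ K := FreeLieAlgebra.lift R fun x =>
    ⟨of R x, 2, Submodule.subset_span ⟨1, one_lt_two, .of trivial⟩⟩
  have hF : K.incl.comp F = LieHom.id := by ext x; simp [F]
  have := LieHom.congr_fun hF h
  simp only [LieHom.comp_apply, LieHom.id_apply] at this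
  rw [← this]
  exact (F h).2

theorem eq_zero_of_mem_lieHom_one {S : Set X} {h : FreeLieAlgebra R X} (hh : h ∈ lieHom R S 1)
    (h0 : toAssoc R X h = 0) : h = 0 := by
  have hspan : h ∈ Submodule.span R (Set.range (of R : X → _)) := by
    refine Submodule.span_mono ?_ hh
    intro u hu
    generalize hk : 1 = k at hu
    induction hu with
    | of => exact ⟨_, rfl⟩
    | lie hu hv => have := hu.pos; have := hv.pos; omega
  obtain ⟨f, rfl⟩ := Finsupp.mem_span_range_iff_exists_finsupp.1 hspan
  suffices f = 0 by simp [this]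
  ext x
  have := congrArg (fun p => coeff p (FreeMonoid.of x)) h0
  simp only [Finsupp.sum, map_sum, map_smul, toAssoc_of, letter, coeff_sum] at this
  classical
  simpa [Finsupp.single_apply,
    FreeMonoid.of_injective.eq_iff] using this

theorem eq_zero_of_mem_lieLT (n : ℕ) : ∀ {X : Type*} {h : FreeLieAlgebra R X},
    h ∈ lieLT R X n → toAssoc R X h = 0 → h = 0 := by
  induction n with
  | zero =>
    intro X h hh _
    simpa [lieLT] using hh
  | succ n ih =>
    intro X h hh h0
    obtain ⟨S, hS, hh⟩ := exists_finite_of_mem_lieLT_succ hh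
    obtain ⟨s, hs⟩ : ∃ s, S.ncard = s := ⟨_, rfl⟩
    induction s using Nat.strong_induction_on generalizing X with
    | _ s ihs =>
      by_cases hn : n = 1
      · subst hn
        refine eq_zero_of_mem_lieHom_one (S := S) ?_ h0
        have hle : lieLT R X 1 ≤ lieHom R S 1 := by
          refine Submodule.span_le.2 ?_
          rintro u ⟨k, hk, hu⟩
          exact absurd hu.pos (by omega)
        rwa [sup_eq_left.2 hle] at hh
      rcases S.eq_empty_or_nonempty with rfl | ⟨x, hx⟩
      · have hle : lieHom R (∅ : Set X) n ≤ lieLT R X n := by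
          refine Submodule.span_le.2 fun u hu => ?_
          exfalso
          clear * - hu
          induction hu with
          | of hx => exact hx
          | lie _ _ hu _ => exact hu
        rw [sup_eq_right.2 hle] at hh
        exact ih hh h0
      · obtain ⟨c, v, hv, rfl⟩ := exists_eq_smul_add_elim x hn hh
        have hinj : Set.InjOn (fun z : {y // y ≠ x} × ℕ => z.1.1) (elimSet x S) := by
          rintro ⟨y, m⟩ ⟨-, rfl⟩ ⟨z, k⟩ ⟨-, rfl⟩ hyz
          exact Prod.ext (Subtype.ext hyz) rfl
        have hmaps : Set.MapsTo (fun z : {y // y ≠ x} × ℕ => z.1.1) (elimSet x S) (S \ {x}) :=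
          fun z hz => ⟨hz.1, z.1.2⟩
        have hlt : (elimSet x S).ncard < s := by
          refine (Set.ncard_le_ncard_of_injOn _ hmaps hinj hS.sdiff).trans_lt ?_
          rw [← hs]
          exact Set.ncard_sdiff_singleton_lt_of_mem hx hS
        have hle : lieHom R (elimSet x S) n ⊔ lieLT R ({y // y ≠ x} × ℕ) n ≤
            lieLT R ({y // y ≠ x} × ℕ) (n + 1) :=
          sup_le (lieHom_le_lieLT n.lt_succ_self) (lieLT_mono n.le_succ)
        have hv0 : v = 0 := ihs _ hlt (hle hv)
          (eq_zero_of_toAssoc_add h0) (elimSet x S)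
          (Set.Finite.of_injOn hmaps hinj hS.sdiff) hv rfl
        rw [hv0, map_zero, add_zero] at h0 ⊢
        have := congrArg (fun p => coeff p (FreeMonoid.of x)) h0
        have hc : c = 0 := by simpa [letter] using this
        rw [hc, zero_smul]

/-- The free Lie algebra embeds into the free associative algebra. -/
theorem toAssoc_injective : Function.Injective (toAssoc R X) := by
  refine (injective_iff_map_eq_zero _).2 fun h h0 => ?_
  obtain ⟨n, hn⟩ := exists_mem_lieLT h
  exact eq_zero_of_mem_lieLT n hn h0

end FreeLieAlgebra

end ToAssoc

namespace FreeAssoc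

section Homogeneous

variable {K X : Type*} [Field K]

/-- All the words in the support have length `n`. -/
def IsHom (n : ℕ) (f : FreeAssoc K X) : Prop := ∀ m, coeff f m ≠ 0 → m.length = n

theorem coeff_hom_mul {n : ℕ} {f : FreeAssoc K X} (hf : IsHom n f) (p : FreeAssoc K X)
    {v : FreeMonoid X} (hv : v.length = n) (z : FreeMonoid X) :
    coeff (f * p) (v * z) = coeff f v * coeff p z := by
  classical
  have hsum : f * p = ∑ m ∈ f.coeff.support, single m (f.coeff m) * p := by
    conv_lhs => rw [← sum_coeff_single f]
    rw [Finsupp.sum, Finset.sum_mul]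
  have hz : ∀ m ∈ f.coeff.support, m ≠ v →
      coeff (single m (f.coeff m) * p) (v * z) = 0 := by
    intro m hm hmv
    refine coeff_single_mul_of_forall_mul_ne _ _ fun d hd => hmv ?_
    have hlen : m.length = v.length := (hf m (Finsupp.mem_support_iff.1 hm)).trans hv.symm
    exact (List.append_inj (congrArg FreeMonoid.toList hd) hlen).1
  rw [hsum, coeff_sum, Finsupp.finsetSum_apply, Finset.sum_eq_single v hz, coeff_single_mul_mul]
  intro hv
  rw [Finsupp.notMem_support_iff.1 hv]
  simp

theorem coeff_letter_mul (x : X) (p : FreeAssoc K X) (m : FreeMonoid X) :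
    coeff (letter K x * p) (FreeMonoid.of x * m) = coeff p m := by
  rw [letter, coeff_single_mul_mul, one_mul]

theorem coeff_mul_letter (x : X) (p : FreeAssoc K X) (m : FreeMonoid X) :
    coeff (p * letter K x) (m * FreeMonoid.of x) = coeff p m := by
  rw [letter, coeff_mul_single_mul, mul_one]

theorem coeff_letter_mul_of_ne {x y : X} (h : x ≠ y) (p : FreeAssoc K X) (m : FreeMonoid X) :
    coeff (letter K x * p) (FreeMonoid.of y * m) = 0 := by
  refine coeff_single_mul_of_forall_mul_ne _ _ fun d hd => h ?_
  have := congrArg FreeMonoid.toList hd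
  simp only [FreeMonoid.toList_of_mul, List.cons.injEq] at this
  exact this.1

theorem exists_append {m : FreeMonoid X} {n : ℕ} (h : n ≤ m.length) :
    ∃ v z : FreeMonoid X, v.length = n ∧ m = v * z :=
  ⟨FreeMonoid.ofList (m.toList.take n), FreeMonoid.ofList (m.toList.drop n),
    List.length_take_of_le h, (List.take_append_drop n m.toList).symm⟩

theorem coeff_hom_mul_of_lt {n : ℕ} {f : FreeAssoc K X} (hf : IsHom n f) (p : FreeAssoc K X)
    {m : FreeMonoid X} (hm : m.length < n) : coeff (f * p) m = 0 := by
  classical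
  have hsum : f * p = ∑ m ∈ f.coeff.support, single m (f.coeff m) * p := by
    conv_lhs => rw [← sum_coeff_single f]
    rw [Finsupp.sum, Finset.sum_mul]
  rw [hsum, coeff_sum, Finsupp.finsetSum_apply]
  refine Finset.sum_eq_zero fun v hv => ?_
  refine coeff_single_mul_of_forall_mul_ne _ _ fun d hd => ?_
  have := hf v (Finsupp.mem_support_iff.1 hv)
  rw [← hd, FreeMonoid.length_mul] at hm
  omega

theorem IsHom.letter (x : X) : IsHom 1 (letter K x) := by
  classical
  intro m hm
  rw [FreeAssoc.letter, coeff_single, Finsupp.single_apply] at hm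
  split_ifs at hm with h
  · rw [← h]; rfl
  · exact absurd rfl hm

theorem IsHom.mul {a b : ℕ} {f g : FreeAssoc K X} (hf : IsHom a f) (hg : IsHom b g) :
    IsHom (a + b) (f * g) := by
  intro m hm
  rcases lt_or_ge m.length a with h | h
  · exact absurd (coeff_hom_mul_of_lt hf g h) hm
  · obtain ⟨v, z, hv, rfl⟩ := exists_append h
    rw [coeff_hom_mul hf g hv] at hm
    rw [FreeMonoid.length_mul, hv, hg z (right_ne_zero_of_mul hm)]

theorem IsHom.eq_smul_one {f : FreeAssoc K X} (hf : IsHom 0 f) : f = coeff f 1 • 1 := by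
  classical
  apply coeff_injective
  ext m
  rw [coeff_smul_apply, one_def, coeff_single, Finsupp.single_apply]
  split_ifs with h
  · simp [← h]
  · rw [smul_zero]
    by_contra hm
    exact h (FreeMonoid.length_eq_zero.1 (hf m hm)).symm

/-- The weak algorithm for homogeneous elements. -/
theorem IsHom.exists_eq_mul {a b : ℕ} {f g p r : FreeAssoc K X} (hf : IsHom a f)
    (hg : IsHom b g) (hba : b ≤ a) (h : f * p = g * r) (hp : p ≠ 0) :
    ∃ q, IsHom (a - b) q ∧ f = g * q := by
  classical
  obtain ⟨z, hz⟩ : ∃ z, coeff p z ≠ 0 := by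
    by_contra! hz
    exact hp (coeff_injective (Finsupp.ext hz))
  let q : FreeAssoc K X := (coeff p z)⁻¹ • ofCoeff
    ((Finsupp.comapDomain (· * z) (coeff r) (mul_left_injective z).injOn).filter
      fun v => v.length = a - b)
  have hq : ∀ v : FreeMonoid X, v.length = a - b → coeff q v * coeff p z = coeff r (v * z) := by
    intro v hv
    simp only [q, coeff_smul_apply, Finsupp.filter_apply, if_pos hv,
      Finsupp.comapDomain_apply, smul_eq_mul]
    field_simp
  have hqhom : IsHom (a - b) q := by
    intro v hv
    by_contra hne
    apply hv
    simp only [q, coeff_smul_apply, Finsupp.filter_apply, if_neg hne, smul_zero]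
  refine ⟨q, hqhom, coeff_injective (Finsupp.ext fun m => ?_)⟩
  by_cases hm : m.length = a
  · obtain ⟨v, w, hv, rfl⟩ := exists_append (hba.trans_eq hm.symm)
    have hw : w.length = a - b := by rw [FreeMonoid.length_mul] at hm; omega
    have := congrArg (fun e => coeff e (v * w * z)) h
    rw [coeff_hom_mul hf p hm, mul_assoc v, coeff_hom_mul hg r hv, ← hq w hw, ← mul_assoc] at this
    rw [coeff_hom_mul hg q hv]
    exact mul_right_cancel₀ hz this
  · have h1 : coeff f m = 0 := by
      by_contra hne
      exact hm (hf m hne)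
    have h2 : coeff (g * q) m = 0 := by
      by_contra hne
      have := hg.mul hqhom m hne
      omega
    rw [h1, h2]

theorem eval_eq_of_two {B : Type*} [Ring B] [Algebra K B] (f g : B) {p : FreeAssoc K (Fin 2)} :
    ∃ (c : K) (p₀ p₁ : FreeAssoc K (Fin 2)),
      p = c • 1 + letter K 0 * p₀ + letter K 1 * p₁ ∧
      eval ![f, g] p = c • 1 + f * eval ![f, g] p₀ + g * eval ![f, g] p₁ := by
  have : ∃ (c : K) (p₀ p₁ : FreeAssoc K (Fin 2)),
      p = c • 1 + letter K 0 * p₀ + letter K 1 * p₁ := by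
    induction p using MonoidAlgebra.induction_linear with
    | zero => exact ⟨0, 0, 0, by simp⟩
    | add p q hp hq =>
      obtain ⟨c, p₀, p₁, rfl⟩ := hp
      obtain ⟨d, q₀, q₁, rfl⟩ := hq
      exact ⟨c + d, p₀ + q₀, p₁ + q₁, by rw [add_smul]; noncomm_ring⟩
    | single m c =>
      induction m using FreeMonoid.casesOn with
      | one => exact ⟨c, 0, 0, by simp [one_def]⟩
      | of_mul x m =>
        rw [single_of_mul]
        fin_cases x
        · exact ⟨0, single m c, 0, by simp⟩
        · exact ⟨0, 0, single m c, by simp⟩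
  obtain ⟨c, p₀, p₁, rfl⟩ := this
  exact ⟨c, p₀, p₁, rfl, by simp⟩

theorem coeff_eq_zero_of_eval {a b : ℕ} {f g : FreeAssoc K X} (hf : IsHom a f) (hg : IsHom b g)
    (ha : 0 < a) (hb : 0 < b) (hind : ∀ p r, f * p = g * r → p = 0 ∧ r = 0)
    (m : FreeMonoid (Fin 2)) :
    ∀ p : FreeAssoc K (Fin 2), eval ![f, g] p = 0 → coeff p m = 0 := by
  have hc : ∀ (c : K) (e₀ e₁ : FreeAssoc K X), c • 1 + f * e₀ + g * e₁ = 0 → c = 0 := by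
    intro c e₀ e₁ e
    have hc := congrArg (fun e => coeff e 1) e
    simpa [coeff_hom_mul_of_lt hf _ (show FreeMonoid.length 1 < a from ha),
      coeff_hom_mul_of_lt hg _ (show FreeMonoid.length 1 < b from hb)] using hc
  induction m using FreeMonoid.inductionOn' with
  | one =>
    intro p hp
    obtain ⟨c, p₀, p₁, rfl, e⟩ := eval_eq_of_two f g (p := p)
    rw [hp] at e
    have h0 := coeff_hom_mul_of_lt (IsHom.letter (K := K) (0 : Fin 2)) p₀ (m := 1) one_pos
    have h1 := coeff_hom_mul_of_lt (IsHom.letter (K := K) (1 : Fin 2)) p₁ (m := 1) one_pos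
    simp [h0, h1, hc _ _ _ e.symm]
  | of_mul i m ih =>
    intro p hp
    obtain ⟨c, p₀, p₁, rfl, e⟩ := eval_eq_of_two f g (p := p)
    rw [hp] at e
    have hc0 := hc _ _ _ e.symm
    subst hc0
    obtain ⟨e₀, e₁⟩ := hind (eval ![f, g] p₀) (-eval ![f, g] p₁) (by
      rw [mul_neg, eq_neg_iff_add_eq_zero, e, zero_smul, zero_add])
    rw [neg_eq_zero] at e₁
    fin_cases i
    · have := coeff_letter_mul_of_ne (K := K) (show (1 : Fin 2) ≠ 0 by decide) p₁ m
      simp [coeff_letter_mul, this, ih p₀ e₀]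
    · have := coeff_letter_mul_of_ne (K := K) (show (0 : Fin 2) ≠ 1 by decide) p₀ m
      simp [coeff_letter_mul, this, ih p₁ e₁]

/-- The substitution `s ↦ ts`, `t ↦ t` on words in two letters. -/
def wordSubst : FreeMonoid (Fin 2) →* FreeMonoid (Fin 2) :=
  FreeMonoid.lift ![FreeMonoid.of 1 * FreeMonoid.of 0, FreeMonoid.of 1]

theorem wordSubst_ne (m n : FreeMonoid (Fin 2)) : wordSubst m ≠ FreeMonoid.of 0 * n := by
  intro h
  have h := congrArg FreeMonoid.toList h
  induction m using FreeMonoid.casesOn with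
  | one => simp at h
  | of_mul i m => fin_cases i <;> simp [wordSubst, FreeMonoid.toList_mul] at h

theorem wordSubst_injective : Function.Injective wordSubst := by
  intro m
  induction m using FreeMonoid.inductionOn' with
  | one =>
    intro n h
    induction n using FreeMonoid.casesOn with
    | one => rfl
    | of_mul i n =>
      have h := congrArg FreeMonoid.toList h
      fin_cases i <;> simp [wordSubst, FreeMonoid.toList_mul] at h
  | of_mul i m ih =>
    intro n h
    induction n using FreeMonoid.casesOn with
    | one =>
      have h := congrArg FreeMonoid.toList h
      fin_cases i <;> simp [wordSubst, FreeMonoid.toList_mul] at h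
    | of_mul j n =>
      have h0 : wordSubst (FreeMonoid.of 0) = FreeMonoid.of 1 * FreeMonoid.of 0 := by
        simp [wordSubst]
      have h1 : wordSubst (FreeMonoid.of 1) = FreeMonoid.of 1 := by simp [wordSubst]
      rw [map_mul, map_mul] at h
      by_cases hij : i = j
      · subst hij
        rw [ih (mul_left_cancel h)]
      · exfalso
        rcases (show (i = 0 ∧ j = 1) ∨ (i = 1 ∧ j = 0) by omega) with ⟨rfl, rfl⟩ | ⟨rfl, rfl⟩
        · rw [h0, h1, mul_assoc] at h
          exact wordSubst_ne _ _ (mul_left_cancel h).symm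
        · rw [h0, h1, mul_assoc] at h
          exact wordSubst_ne _ _ (mul_left_cancel h)

theorem eval_wordSubst_injective : Function.Injective
    (eval ![letter K 1 * letter K 0, letter K 1] : FreeAssoc K (Fin 2) →ₐ[K] FreeAssoc K (Fin 2)) := by
  have : (eval ![letter K 1 * letter K 0, letter K 1] : FreeAssoc K (Fin 2) →ₐ[K] FreeAssoc K (Fin 2)) =
      mapDomainAlgHom K K wordSubst := by
    refine algHom_ext fun i => ?_
    fin_cases i <;> simp <;> simp [letter, wordSubst, mapDomain_single]
  rw [this]
  exact mapDomain_injective wordSubst_injective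

theorem eval_swap {B : Type*} [Ring B] [Algebra K B] (f g : B) (p : FreeAssoc K (Fin 2)) :
    eval ![f, g] p = eval ![g, f] (eval ![letter K 1, letter K 0] p) := by
  rw [eval_comp]
  congr 2
  ext i
  fin_cases i <;> simp

theorem eval_injective_swap {B : Type*} [Ring B] [Algebra K B] {f g : B}
    (h : Function.Injective (eval ![g, f] : FreeAssoc K (Fin 2) →ₐ[K] B)) :
    Function.Injective (eval ![f, g] : FreeAssoc K (Fin 2) →ₐ[K] B) := by
  intro p q e
  rw [eval_swap f g p, eval_swap f g q] at e
  have e := congrArg (eval (![letter K 1, letter K 0] : Fin 2 → FreeAssoc K (Fin 2))) (h e)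
  have hl : (![letter K 0, letter K 1] : Fin 2 → FreeAssoc K (Fin 2)) = letter K :=
    funext fun i => by fin_cases i <;> rfl
  rwa [← eval_swap, ← eval_swap, hl, eval_letter_self, eval_letter_self] at e

theorem IsHom.pos_of_not_commute {n : ℕ} {f g : FreeAssoc K X} (hf : IsHom n f)
    (h : ¬ Commute f g) : 0 < n := by
  by_contra hn
  obtain rfl : n = 0 := by omega
  rw [hf.eq_smul_one] at h
  exact h ((Commute.one_left g).smul_left _)

/-- Two noncommuting homogeneous elements of the free associative algebra are free generators
of a free subalgebra. -/
theorem eval_injective_of_not_commute {f g : FreeAssoc K X} {a b : ℕ} (hf : IsHom a f)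
    (hg : IsHom b g) (h : ¬ Commute f g) :
    Function.Injective (eval ![f, g] : FreeAssoc K (Fin 2) →ₐ[K] FreeAssoc K X) := by
  obtain ⟨n, hn⟩ : ∃ n, a + b = n := ⟨_, rfl⟩
  induction n using Nat.strong_induction_on generalizing f g a b with
  | _ n ih =>
    wlog hba : b ≤ a generalizing f g a b
    · exact eval_injective_swap (this hg hf (fun hc => h hc.symm) (by omega) (by omega))
    by_cases hind : ∀ p r, f * p = g * r → p = 0
    · refine (injective_iff_map_eq_zero _).2 fun p hp => coeff_injective (Finsupp.ext fun m => ?_)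
      refine coeff_eq_zero_of_eval hf hg (hf.pos_of_not_commute h)
        (hg.pos_of_not_commute fun hc => h hc.symm) ?_ m p hp
      intro p r e
      have hp := hind p r e
      refine ⟨hp, ?_⟩
      rw [hp, mul_zero] at e
      rcases mul_eq_zero.1 e.symm with hg0 | hr
      · exact absurd (hg0 ▸ Commute.zero_right f) h
      · exact hr
    · push Not at hind
      obtain ⟨p, r, e, hp⟩ := hind
      obtain ⟨q, hq, rfl⟩ := hf.exists_eq_mul hg hba e hp
      have hqg : ¬ Commute q g := fun hc => h ((Commute.refl g).mul_left hc)
      have hb := hg.pos_of_not_commute fun hc => h hc.symm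
      have hinj := ih _ (by omega) hq hg hqg rfl
      intro p r e
      apply eval_wordSubst_injective
      apply hinj
      have hv : (fun i => eval ![q, g] ((![letter K 1 * letter K 0, letter K 1] :
          Fin 2 → FreeAssoc K (Fin 2)) i)) = ![g * q, g] :=
        funext fun i => by fin_cases i <;> simp
      rw [eval_comp, eval_comp, hv, e]

theorem eq_of_commute_letter_aux {s : X} {p : FreeAssoc K X} (h : Commute p (letter K s))
    (l : FreeMonoid X) :
    ∀ m, coeff p (l * m) ≠ 0 → l = FreeMonoid.of s ^ l.length := by
  induction l using FreeMonoid.inductionOn' with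
  | one => intro _ _; rfl
  | of_mul x l ih =>
    intro m hm
    have e : coeff (p * letter K s) (FreeMonoid.of x * (l * m) * FreeMonoid.of s) =
      coeff p (FreeMonoid.of x * (l * m)) := coeff_mul_letter _ _ _
    rw [h.eq, mul_assoc] at e
    by_cases hx : s = x
    · subst hx
      rw [coeff_letter_mul, mul_assoc] at e
      have := ih (m * FreeMonoid.of s) (by rwa [mul_assoc, ← e] at hm)
      rw [FreeMonoid.length_mul, FreeMonoid.length_of, pow_add, pow_one, ← this]
    · rw [coeff_letter_mul_of_ne hx] at e
      rw [mul_assoc, ← e] at hm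
      exact absurd rfl hm

/-- An element which commutes with a letter is a polynomial in this letter. -/
theorem eq_pow_of_commute_letter {s : X} {p : FreeAssoc K X} (h : Commute p (letter K s))
    {m : FreeMonoid X} (hm : coeff p m ≠ 0) : m = FreeMonoid.of s ^ m.length :=
  eq_of_commute_letter_aux h m 1 (by rwa [mul_one])

end Homogeneous

section Degree

variable {K X : Type*} [Field K]

/-- The weight of a word in two letters, for given weights of the letters. -/
def weight (wt : Fin 2 → ℕ) (m : FreeMonoid (Fin 2)) : ℕ := (m.toList.map wt).sum

theorem weight_of_mul (wt : Fin 2 → ℕ) (i : Fin 2) (m : FreeMonoid (Fin 2)) :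
    weight wt (FreeMonoid.of i * m) = wt i + weight wt m := by
  simp [weight]

theorem eq_pow_or_weight_ge (wt : Fin 2 → ℕ) (m : FreeMonoid (Fin 2)) :
    (∃ i, m = FreeMonoid.of i ^ m.length) ∨ wt 0 + wt 1 ≤ weight wt m := by
  induction m using FreeMonoid.inductionOn' with
  | one => exact .inl ⟨0, rfl⟩
  | of_mul j m ih =>
    rcases ih with ⟨i, hm⟩ | ih
    · by_cases hij : i = j
      · subst hij
        refine .inl ⟨i, ?_⟩
        rw [FreeMonoid.length_mul, FreeMonoid.length_of, pow_add, pow_one, ← hm]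
      · induction m using FreeMonoid.casesOn with
        | one => exact .inl ⟨j, by simp⟩
        | of_mul l m =>
          right
          have hl : l = i := by
            have h := congrArg FreeMonoid.toList hm
            rw [FreeMonoid.length_mul, FreeMonoid.length_of, pow_add, pow_one] at h
            simp only [FreeMonoid.toList_of_mul, List.cons.injEq] at h
            exact h.1
          rw [weight_of_mul, weight_of_mul, hl]
          rcases (show (i = 0 ∧ j = 1) ∨ (i = 1 ∧ j = 0) by omega) with ⟨rfl, rfl⟩ | ⟨rfl, rfl⟩ <;>
          omega
    · right
      rw [weight_of_mul]
      omega

theorem lift_polynomial {B : Type*} [Ring B] {U : Fin 2 → Polynomial B} {wt : Fin 2 → ℕ}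
    (hU : ∀ i, (U i).natDegree ≤ wt i) (m : FreeMonoid (Fin 2)) :
    (FreeMonoid.lift U m).natDegree ≤ weight wt m ∧
      (FreeMonoid.lift U m).coeff (weight wt m) =
        FreeMonoid.lift (fun i => (U i).coeff (wt i)) m := by
  induction m using FreeMonoid.inductionOn' with
  | one => simp [weight]
  | of_mul j m ih =>
    rw [weight_of_mul, map_mul, map_mul, FreeMonoid.lift_eval_of, FreeMonoid.lift_eval_of]
    exact ⟨Polynomial.natDegree_mul_le_of_le (hU j) ih.1,
      by rw [Polynomial.coeff_mul_add_eq_of_natDegree_le (hU j) ih.1, ih.2]⟩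

/-- The component of a given weight. -/
noncomputable def part (wt : Fin 2 → ℕ) (D : ℕ) (p : FreeAssoc K (Fin 2)) : FreeAssoc K (Fin 2) :=
  ofCoeff ((coeff p).filter fun m => weight wt m = D)

theorem eval_eq_sum {B : Type*} [Ring B] [Algebra K B] (φ : X → B) (p : FreeAssoc K X) :
    eval φ p = (coeff p).sum fun m c => c • FreeMonoid.lift φ m := by
  rw [eval, MonoidAlgebra.lift_apply]

theorem eval_polynomial {B : Type*} [Ring B] [Algebra K B] {U : Fin 2 → Polynomial B}
    {wt : Fin 2 → ℕ} (hU : ∀ i, (U i).natDegree ≤ wt i) {p : FreeAssoc K (Fin 2)} {D : ℕ}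
    (hD : ∀ m, coeff p m ≠ 0 → weight wt m ≤ D) :
    (eval U p).natDegree ≤ D ∧
      (eval U p).coeff D = eval (fun i => (U i).coeff (wt i)) (part wt D p) := by
  classical
  rw [eval_eq_sum, eval_eq_sum]
  constructor
  · refine Polynomial.natDegree_sum_le_of_forall_le _ _ fun m hm => ?_
    exact (Polynomial.natDegree_smul_le _ _).trans
      ((lift_polynomial hU m).1.trans (hD m (Finsupp.mem_support_iff.1 hm)))
  · rw [part, coeff_ofCoeff, Finsupp.sum_filter_index, Finsupp.sum, Polynomial.finsetSum_coeff,
      Finsupp.support_filter, Finset.sum_filter]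
    refine Finset.sum_congr rfl fun m hm => ?_
    rw [Polynomial.coeff_smul]
    split_ifs with h
    · rw [← h, (lift_polynomial hU m).2]
    · rw [Polynomial.coeff_eq_zero_of_natDegree_lt, smul_zero]
      have := hD m (Finsupp.mem_support_iff.1 hm)
      have := (lift_polynomial hU m).1
      omega

/-- The generating polynomial of the homogeneous components of an element. -/
noncomputable def grade : FreeAssoc K X →ₐ[K] Polynomial (FreeAssoc K X) :=
  eval fun x => Polynomial.monomial 1 (letter K x)

theorem grade_single (m : FreeMonoid X) (c : K) :
    grade (single m c) = Polynomial.monomial m.length (single m c) := by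
  have : FreeMonoid.lift (fun x => Polynomial.monomial 1 (letter K x)) m =
      Polynomial.monomial m.length (single m 1) := by
    induction m using FreeMonoid.inductionOn' with
    | one => rfl
    | of_mul x m ih =>
      rw [map_mul, FreeMonoid.lift_eval_of, ih, Polynomial.monomial_mul_monomial,
        FreeMonoid.length_mul, FreeMonoid.length_of, single_of_mul]
  rw [grade, eval_single, this, Polynomial.smul_monomial, smul_single, smul_eq_mul, mul_one]

theorem coeff_grade_coeff (p : FreeAssoc K X) (n : ℕ) (m : FreeMonoid X) :
    coeff ((grade p).coeff n) m = if m.length = n then coeff p m else 0 := by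
  classical
  induction p using MonoidAlgebra.induction_linear with
  | zero => simp
  | add p q hp hq =>
    rw [map_add, Polynomial.coeff_add, coeff_add, Finsupp.add_apply, hp, hq]
    split_ifs <;> simp
  | single l c =>
    rw [grade_single, Polynomial.coeff_monomial]
    by_cases hl : l = m
    · subst hl
      split_ifs <;> simp
    · split_ifs <;> simp [hl]

/-- The degree of an element of the free associative algebra. -/
noncomputable def deg (p : FreeAssoc K X) : ℕ := (grade p).natDegree

/-- The homogeneous component of highest degree. -/
noncomputable def top (p : FreeAssoc K X) : FreeAssoc K X := (grade p).leadingCoeff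

theorem isHom_top (p : FreeAssoc K X) : IsHom (deg p) (top p) := by
  intro m hm
  rw [top, Polynomial.leadingCoeff, coeff_grade_coeff] at hm
  by_contra h
  exact hm (if_neg h)

theorem deg_smul_le (c : K) (p : FreeAssoc K X) : deg (c • p) ≤ deg p := by
  rw [deg, map_smul]
  exact Polynomial.natDegree_smul_le _ _

theorem deg_add_le (p q : FreeAssoc K X) : deg (p + q) ≤ max (deg p) (deg q) := by
  rw [deg, map_add]
  exact Polynomial.natDegree_add_le _ _

theorem top_smul {c : K} (hc : c ≠ 0) (p : FreeAssoc K X) : top (c • p) = c • top p := by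
  rw [top, map_smul]
  exact Polynomial.leadingCoeff_smul_of_smul_regular _ (IsSMulRegular.of_ne_zero hc)

theorem deg_smul {c : K} (hc : c ≠ 0) (p : FreeAssoc K X) : deg (c • p) = deg p := by
  rw [deg, map_smul]
  exact Polynomial.natDegree_smul_of_smul_regular _ (IsSMulRegular.of_ne_zero hc)

theorem top_add_of_deg_lt {p q : FreeAssoc K X} (h : deg q < deg p) : top (p + q) = top p := by
  rw [top, map_add]
  exact Polynomial.leadingCoeff_add_of_degree_lt' (Polynomial.degree_lt_degree h)

theorem deg_add_of_deg_lt {p q : FreeAssoc K X} (h : deg q < deg p) : deg (p + q) = deg p := by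
  rw [deg, map_add]
  exact Polynomial.natDegree_add_eq_left_of_natDegree_lt h

/-- The leading components of `q + p(u, w)` when those of `u` and `w` do not commute. -/
theorem deg_lt_and_not_commute_top {u w q : FreeAssoc K X} {p : FreeAssoc K (Fin 2)}
    (hc : ¬ Commute (top u) (top w)) (hq : deg q ≤ deg u) (hp : p ≠ 0)
    (hmix : ∀ i n, coeff p (FreeMonoid.of i ^ n) = 0) :
    deg u < deg (q + eval ![u, w] p) ∧ ¬ Commute (top (q + eval ![u, w] p)) (top u) ∧
      ¬ Commute (top (q + eval ![u, w] p)) (top w) := by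
  have hw : 0 < deg w := (isHom_top w).pos_of_not_commute fun h => hc h.symm
  let wt : Fin 2 → ℕ := ![deg u, deg w]
  obtain ⟨l, hl, hmax⟩ := (coeff p).support.exists_max_image (weight wt)
    (Finsupp.support_nonempty_iff.2 fun h => hp (coeff_eq_zero.1 h))
  rw [Finsupp.mem_support_iff] at hl
  set D := weight wt l with hD
  have hDu : deg u < D := by
    rcases eq_pow_or_weight_ge wt l with ⟨i, hi⟩ | h
    · rw [hi, hmix] at hl
      exact absurd rfl hl
    · have : deg u + deg w ≤ D := h
      omega
  set π := part wt D p with hπ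
  have hπ0 : π ≠ 0 := by
    intro h
    have : coeff π l = coeff p l := by simp [hπ, part, hD]
    rw [h] at this
    exact hl this.symm
  have hπmix : ∀ i n, coeff π (FreeMonoid.of i ^ n) = 0 := by
    intro i n
    rw [hπ, part, coeff_ofCoeff, Finsupp.filter_apply, hmix, ite_self]
  have hπcomm : ∀ i, ¬ Commute π (letter K i) := by
    intro i h
    apply hπ0
    refine coeff_injective (Finsupp.ext fun m => ?_)
    by_contra hm
    have := eq_pow_of_commute_letter h hm
    rw [this, hπmix] at hm
    exact hm rfl
  have hinj := eval_injective_of_not_commute (isHom_top u) (isHom_top w) hc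
  have hU : ∀ i, (grade ((![u, w] : Fin 2 → FreeAssoc K X) i)).natDegree ≤ wt i := by
    intro i
    fin_cases i <;> exact le_rfl
  have hV : (fun i => (grade ((![u, w] : Fin 2 → FreeAssoc K X) i)).coeff (wt i)) =
      ![top u, top w] := by
    funext i
    fin_cases i <;> rfl
  obtain ⟨h1, h2⟩ := eval_polynomial hU (p := p) (D := D)
    fun m hm => hmax m (Finsupp.mem_support_iff.2 hm)
  rw [hV, ← eval_comp, ← hπ] at h2
  rw [← eval_comp] at h1
  have hne : eval ![top u, top w] π ≠ 0 := fun h => hπ0 (hinj (h.trans (map_zero _).symm))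
  have hdeg : deg (eval ![u, w] p) = D :=
    h1.antisymm (Polynomial.le_natDegree_of_ne_zero (h2.trans_ne hne))
  have htop : top (eval ![u, w] p) = eval ![top u, top w] π := by
    rw [← h2, ← hdeg]
    rfl
  have hcomm : ∀ i, ¬ Commute (eval ![top u, top w] π) ((![top u, top w] : Fin 2 → _) i) := by
    intro i h
    apply hπcomm i
    apply hinj
    rw [map_mul, map_mul, eval_letter]
    exact h
  rw [add_comm q, deg_add_of_deg_lt (by omega), top_add_of_deg_lt (by omega), hdeg, htop]
  exact ⟨hDu, hcomm 0, hcomm 1⟩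

theorem IsHom.deg_eq {n : ℕ} {f : FreeAssoc K X} (hf : IsHom n f) (h0 : f ≠ 0) : deg f = n := by
  have hne : grade f ≠ 0 := by
    intro h
    apply h0
    refine coeff_injective (Finsupp.ext fun m => ?_)
    have := coeff_grade_coeff f m.length m
    rw [h, if_pos rfl] at this
    exact this.symm
  by_contra hn
  apply Polynomial.leadingCoeff_ne_zero.2 hne
  refine coeff_injective (Finsupp.ext fun m => ?_)
  by_contra hm
  rw [Polynomial.leadingCoeff, coeff_grade_coeff] at hm
  split_ifs at hm with hd
  · exact hn (hd.symm.trans (hf m hm))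
  · exact hm rfl

theorem IsHom.top_eq {n : ℕ} {f : FreeAssoc K X} (hf : IsHom n f) (h0 : f ≠ 0) : top f = f := by
  refine coeff_injective (Finsupp.ext fun m => ?_)
  have hd := hf.deg_eq h0
  rw [top, Polynomial.leadingCoeff, coeff_grade_coeff, ite_eq_left_iff]
  intro hm
  by_contra hne
  exact hm ((hf m (Ne.symm hne)).trans hd.symm)

theorem not_commute_letter {x y : X} (h : x ≠ y) : ¬ Commute (letter K x) (letter K y) := by
  intro hc
  have := congrArg (fun e => coeff e (FreeMonoid.of x * FreeMonoid.of y)) hc.eq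
  simp only [coeff_letter_mul_of_ne h.symm, coeff_letter_mul] at this
  simp [letter] at this

/-- Substitutions of elements of the polynomial ring in one variable give zero. -/
def Null (p : FreeAssoc K (Fin 2)) : Prop := ∀ r : Fin 2 → Polynomial K, eval r p = 0

theorem coeff_eval_single_X (i : Fin 2) (p : FreeAssoc K (Fin 2)) (n : ℕ) :
    (eval (Pi.single i (Polynomial.X : Polynomial K)) p).coeff n =
      coeff p (FreeMonoid.of i ^ n) := by
  classical
  induction p using MonoidAlgebra.induction_linear with
  | zero => simp
  | add p q hp hq => simp [hp, hq]
  | single m c =>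
    have : FreeMonoid.lift (Pi.single i (Polynomial.X : Polynomial K)) m =
        if m = FreeMonoid.of i ^ m.length then Polynomial.X ^ m.length else 0 := by
      induction m using FreeMonoid.inductionOn' with
      | one => simp
      | of_mul j m ih =>
        rw [map_mul, FreeMonoid.lift_eval_of, ih, FreeMonoid.length_mul, FreeMonoid.length_of,
          pow_add, pow_one]
        by_cases hij : j = i
        · subst hij
          simp only [Pi.single_eq_same, mul_right_inj, mul_ite, mul_zero, pow_add, pow_one]
        · rw [Pi.single_eq_of_ne hij, zero_mul, if_neg]
          intro h
          have h := congrArg FreeMonoid.toList h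
          simp only [FreeMonoid.toList_of_mul, List.cons.injEq] at h
          exact hij h.1
    rw [eval_single, this, Polynomial.coeff_smul]
    by_cases hm : m = FreeMonoid.of i ^ n
    · have hlen : (FreeMonoid.of i ^ n).length = n := by
        clear this hm
        induction n with
        | zero => rfl
        | succ n ih => rw [pow_succ, FreeMonoid.length_mul, ih, FreeMonoid.length_of]
      subst hm
      simp [hlen]
    · rw [coeff_single, Finsupp.single_apply, if_neg hm]
      split_ifs with h
      · rw [Polynomial.coeff_X_pow, if_neg, smul_zero]
        rintro rfl
        exact hm h
      · simp

theorem Null.coeff_pow {p : FreeAssoc K (Fin 2)} (hp : Null p) (i : Fin 2) (n : ℕ) :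
    coeff p (FreeMonoid.of i ^ n) = 0 := by
  rw [← coeff_eval_single_X, hp, Polynomial.coeff_zero]

open Classical in
/-- The expression of `p` in the letter `s` (or `t`, if `β = 0`) and the element
`α s + β t`. -/
noncomputable def change (α β : K) (p : FreeAssoc K (Fin 2)) : FreeAssoc K (Fin 2) :=
  eval (if β ≠ 0 then ![letter K 0, β⁻¹ • (letter K 1 - α • letter K 0)]
    else ![α⁻¹ • letter K 1, letter K 0]) p

theorem eval_change {α β : K} (h : α ≠ 0 ∨ β ≠ 0) {B : Type*} [Ring B] [Algebra K B] {u Y Z : B}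
    (hu : (β ≠ 0 → u = Y) ∧ (β = 0 → u = Z)) (p : FreeAssoc K (Fin 2)) :
    eval ![u, α • Y + β • Z] (change α β p) = eval ![Y, Z] p := by
  rw [change, eval_comp]
  congr 2
  funext i
  by_cases hβ : β = 0
  · have hα : α ≠ 0 := by tauto
    fin_cases i <;> simp [hu.2 hβ, hβ, hα]
  · fin_cases i <;> simp [hu.1 hβ, hβ]

theorem Null.change {p : FreeAssoc K (Fin 2)} (hp : Null p) (α β : K) : Null (change α β p) := by
  intro r
  rw [FreeAssoc.change, eval_comp]
  exact hp _

theorem change_ne_zero {α β : K} (h : α ≠ 0 ∨ β ≠ 0) {p : FreeAssoc K (Fin 2)} (hp : p ≠ 0) :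
    change α β p ≠ 0 := by
  intro h0
  obtain ⟨u, hu⟩ : ∃ u : FreeAssoc K (Fin 2),
      (β ≠ 0 → u = letter K 0) ∧ (β = 0 → u = letter K 1) := by
    by_cases hβ : β = 0
    · exact ⟨letter K 1, by simp [hβ]⟩
    · exact ⟨letter K 0, by simp [hβ]⟩
  have := eval_change h hu p
  have hl : (![letter K 0, letter K 1] : Fin 2 → FreeAssoc K (Fin 2)) = letter K :=
    funext fun i => by fin_cases i <;> rfl
  rw [h0, map_zero, hl, eval_letter_self] at this
  exact hp this.symm

/-- The leading components of `q + p(Y, Z)`, in terms of a nonzero linear combination of `Y`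
and `Z` whose leading component does not commute with that of the complementary generator. -/
theorem deg_lt_and_not_commute_top_of_change {α β : K} (h : α ≠ 0 ∨ β ≠ 0)
    {q u w Y Z : FreeAssoc K X} {p : FreeAssoc K (Fin 2)} (hu : (β ≠ 0 → u = Y) ∧ (β = 0 → u = Z))
    (hw : w = α • Y + β • Z) (hc : ¬ Commute (top u) (top w)) (hq : deg q ≤ deg u) (hp : p ≠ 0)
    (hn : Null p) :
    deg u < deg (q + eval ![Y, Z] p) ∧ ¬ Commute (top (q + eval ![Y, Z] p)) (top u) ∧
      ¬ Commute (top (q + eval ![Y, Z] p)) (top w) := by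
  rw [← eval_change h hu, ← hw]
  exact deg_lt_and_not_commute_top hc hq (change_ne_zero h hp) (hn.change α β).coeff_pow

/-- The first entry dominates the two other ones, and its leading component commutes with the
leading component of no nontrivial linear combination of them. -/
structure Dominates (P : Fin 3 → FreeAssoc K X) : Prop where
  deg_one : deg (P 1) < deg (P 0)
  deg_two : deg (P 2) < deg (P 0)
  not_commute : ∀ α β : K, α ≠ 0 ∨ β ≠ 0 → ¬ Commute (top (P 0)) (top (α • P 1 + β • P 2))

theorem Dominates.base {x y z : X} (hyz : y ≠ z) {p : FreeAssoc K (Fin 2)} (hp : p ≠ 0)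
    (hn : Null p) :
    Dominates ![letter K x + eval ![letter K y, letter K z] p, letter K y, letter K z] := by
  have hl : ∀ x : X, letter K x ≠ 0 := fun x h => by
    have := congrArg (fun e => coeff e (FreeMonoid.of x)) h
    simp [letter] at this
  have hd : ∀ x : X, deg (letter K x) = 1 := fun x => (IsHom.letter x).deg_eq (hl x)
  have ht : ∀ x : X, top (letter K x) = letter K x := fun x => (IsHom.letter x).top_eq (hl x)
  have key : ∀ α β : K, α ≠ 0 ∨ β ≠ 0 →
      1 < deg (letter K x + eval ![letter K y, letter K z] p) ∧
      ¬ Commute (top (letter K x + eval ![letter K y, letter K z] p))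
        (top (α • letter K y + β • letter K z)) := by
    intro α β h
    have hu : ∃ v, ((β ≠ 0 → letter K v = letter K y) ∧ (β = 0 → letter K v = letter K z)) ∧
        ¬ Commute (letter K v) (α • letter K y + β • letter K z) := by
      by_cases hβ : β = 0
      · refine ⟨z, by simp [hβ], fun hc => not_commute_letter (K := K) hyz.symm ?_⟩
        rw [hβ, zero_smul, add_zero] at hc
        exact (Commute.smul_right_iff₀ (by tauto)).1 hc
      · refine ⟨y, by simp [hβ], fun hc => not_commute_letter (K := K) hyz ?_⟩
        have := hc.sub_right ((Commute.refl (letter K y)).smul_right α)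
        rw [add_sub_cancel_left] at this
        exact (Commute.smul_right_iff₀ hβ).1 this
    obtain ⟨v, hv, hc⟩ := hu
    have hwt : top (α • letter K y + β • letter K z) = α • letter K y + β • letter K z := by
      refine IsHom.top_eq (n := 1) ?_ ?_
      · intro m hm
        by_contra hne
        have : ∀ x : X, coeff (letter K x) m = 0 := fun x => by
          by_contra h
          exact hne (IsHom.letter x m h)
        apply hm
        rw [coeff_add, Finsupp.add_apply, coeff_smul_apply, coeff_smul_apply, this, this]
        simp
      · intro h0
        rw [h0] at hc
        exact hc (Commute.zero_right _)
    obtain ⟨h1, -, h2⟩ := deg_lt_and_not_commute_top_of_change h hv rfl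
      (q := letter K x) (by rwa [hwt, ht]) (by rw [hd, hd]) hp hn
    rw [hd] at h1
    exact ⟨h1, h2⟩
  have h1 := (key 1 0 (by simp)).1
  exact ⟨by rwa [← hd y] at h1, by rwa [← hd z] at h1, fun α β h => (key α β h).2⟩

/-- A combination of `y` and `z` in terms of `a y - b z` and the complementary generator. -/
theorem exists_combination {V : Type*} [AddCommGroup V] [Module K V] {a b : K}
    (h : a ≠ 0 ∨ b ≠ 0) {α β : K} (hαβ : α ≠ 0 ∨ β ≠ 0) {u y z : V}
    (hu : (b ≠ 0 → u = y) ∧ (b = 0 → u = z)) :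
    ∃ c d : K, (c ≠ 0 ∨ d ≠ 0) ∧
      α • y + β • z = c • u + d • (a • y + b • z) := by
  by_cases hb : b = 0
  · subst hb
    have ha : a ≠ 0 := by tauto
    refine ⟨β, α * a⁻¹, ?_, ?_⟩
    · rcases hαβ with h | h
      · exact .inr (mul_ne_zero h (inv_ne_zero ha))
      · exact .inl h
    · rw [hu.2 rfl]
      match_scalars <;> simp [ha]
  · refine ⟨α - β * a * b⁻¹, β * b⁻¹, ?_, ?_⟩
    · by_cases hβ : β = 0
      · left
        simp only [hβ, zero_mul, sub_zero]
        tauto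
      · exact .inr (mul_ne_zero hβ (inv_ne_zero hb))
    · rw [hu.1 hb]
      match_scalars <;> field_simp
      ring

theorem Dominates.step {P Q : Fin 3 → FreeAssoc K X} (hP : Dominates P) {S : Fin 3 → Fin 3 → K}
    (hQ : ∀ i, Q i = S i 0 • P 0 + S i 1 • P 1 + S i 2 • P 2) (hS : S 2 0 ≠ 0 ∨ S 1 0 ≠ 0)
    (hS' : S 2 0 * S 1 1 - S 1 0 * S 2 1 ≠ 0 ∨ S 2 0 * S 1 2 - S 1 0 * S 2 2 ≠ 0)
    {p : FreeAssoc K (Fin 2)} (hp : p ≠ 0) (hn : Null p) :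
    Dominates ![Q 0 + eval ![Q 1, Q 2] p, Q 1, Q 2] := by
  have hlow : ∀ α β : K, deg (α • P 1 + β • P 2) < deg (P 0) := fun α β =>
    (deg_add_le _ _).trans_lt (max_lt ((deg_smul_le _ _).trans_lt hP.deg_one)
      ((deg_smul_le _ _).trans_lt hP.deg_two))
  have hQle : ∀ i, deg (Q i) ≤ deg (P 0) := fun i => by
    rw [hQ, add_assoc]
    exact (deg_add_le _ _).trans (max_le (deg_smul_le _ _) (hlow _ _).le)
  have hQd : ∀ i, S i 0 ≠ 0 → deg (Q i) = deg (P 0) ∧ top (Q i) = S i 0 • top (P 0) := fun i hi => by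
    rw [hQ, add_assoc, deg_add_of_deg_lt, top_add_of_deg_lt, deg_smul hi, top_smul hi]
    · exact ⟨rfl, rfl⟩
    all_goals
      rw [deg_smul hi]
      exact hlow _ _
  obtain ⟨w, hw⟩ : ∃ w, w = S 2 0 • Q 1 + (-S 1 0) • Q 2 := ⟨_, rfl⟩
  have hw' : w = (S 2 0 * S 1 1 - S 1 0 * S 2 1) • P 1 + (S 2 0 * S 1 2 - S 1 0 * S 2 2) • P 2 := by
    rw [hw, hQ 1, hQ 2]
    module
  have hS1 : S 2 0 ≠ 0 ∨ -S 1 0 ≠ 0 := by simpa using hS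
  obtain ⟨u, c, hu, hc, hud, hut⟩ : ∃ (u : FreeAssoc K X) (c : K),
      ((-S 1 0 ≠ 0 → u = Q 1) ∧ (-S 1 0 = 0 → u = Q 2)) ∧
        c ≠ 0 ∧ deg u = deg (P 0) ∧ top u = c • top (P 0) := by
    by_cases h : S 1 0 = 0
    · exact ⟨Q 2, S 2 0, by simp [h], hS.resolve_right (not_not_intro h),
        hQd 2 (hS.resolve_right (not_not_intro h))⟩
    · exact ⟨Q 1, S 1 0, by simp [h], h, hQd 1 h⟩
  have hcomm : ¬ Commute (top u) (top w) := by
    rw [hut, Commute.smul_left_iff₀ hc, hw']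
    exact hP.not_commute _ _ hS'
  have hwd : deg w < deg u := by
    rw [hud, hw']
    exact hlow _ _
  obtain ⟨h1, h2, h3⟩ := deg_lt_and_not_commute_top_of_change (α := S 2 0) (β := -S 1 0)
    (Y := Q 1) (Z := Q 2) hS1 hu hw hcomm ((hQle 0).trans_eq hud.symm) hp hn
  have h1' := hud.symm.trans_lt h1
  refine ⟨(hQle 1).trans_lt h1', (hQle 2).trans_lt h1', fun α β h => ?_⟩
  change ¬ Commute (top (Q 0 + eval ![Q 1, Q 2] p)) (top (α • Q 1 + β • Q 2))
  obtain ⟨a, b, hab, hαβ⟩ := exists_combination hS1 h hu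
  rw [← hw] at hαβ
  rw [hαβ]
  by_cases ha : a = 0
  · have hb : b ≠ 0 := hab.resolve_left (not_not_intro ha)
    rw [ha, zero_smul, zero_add, top_smul hb, Commute.smul_right_iff₀ hb]
    exact h3
  · have hlt : deg (b • w) < deg (a • u) := by
      rw [deg_smul ha]
      exact (deg_smul_le _ _).trans_lt hwd
    rw [top_add_of_deg_lt hlt, top_smul ha, Commute.smul_right_iff₀ ha]
    exact h2

theorem Dominates.eq_zero_of_eq_letter {P : Fin 3 → FreeAssoc K X} (hP : Dominates P) {a b c : K}
    {x : X} (h : a • P 0 + b • P 1 + c • P 2 = letter K x) : a = 0 := by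
  by_contra ha
  have h1 : 0 < deg (P 1) := by
    refine (isHom_top _).pos_of_not_commute (g := top (P 0)) fun hc => ?_
    have := hP.not_commute 1 0 (by simp)
    rw [one_smul, zero_smul, add_zero] at this
    exact this hc.symm
  have hd : deg (a • P 0 + (b • P 1 + c • P 2)) = deg (P 0) := by
    rw [deg_add_of_deg_lt, deg_smul ha]
    rw [deg_smul ha]
    exact (deg_add_le _ _).trans_lt (max_lt ((deg_smul_le _ _).trans_lt hP.deg_one)
      ((deg_smul_le _ _).trans_lt hP.deg_two))
  have hl : letter K x ≠ 0 := fun h => by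
    have := congrArg (fun e => coeff e (FreeMonoid.of x)) h
    simp [letter] at this
  rw [← add_assoc, h, (IsHom.letter x).deg_eq hl] at hd
  have := hP.deg_one
  omega

end Degree

end FreeAssoc

section Automorphisms

attribute [local instance] LieRing.ofAssociativeRing

open FreeAssoc

variable {R K : Type*} [CommRing R] [Field K] [Algebra R K]

/-- The canonical map from the free Lie algebra to the free associative algebra over an extension
of the ring of coefficients. -/
noncomputable def FreeLieAlgebra.toAssocOver (R K : Type*) [CommRing R] [Field K] [Algebra R K]
    (X : Type*) : FreeLieAlgebra R X →ₗ⁅R⁆ FreeAssoc K X :=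
  FreeLieAlgebra.lift R (letter K)

namespace FreeLieAlgebra

@[simp]
theorem toAssocOver_of {X : Type*} (x : X) : toAssocOver R K X (of R x) = letter K x := by
  simp [toAssocOver]

theorem toAssocOver_injective (h : Function.Injective (algebraMap R K)) (X : Type*) :
    Function.Injective (toAssocOver R K X) := by
  have key : ∀ u : FreeLieAlgebra R X, toAssocOver R K X u =
      mapAlgHom (FreeMonoid X) (Algebra.ofId R K) (toAssoc R X u) := by
    have : toAssocOver R K X =
        (mapAlgHom (FreeMonoid X) (Algebra.ofId R K)).toLieHom.comp (toAssoc R X) := by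
      ext1 x
      change toAssocOver R K X (of R x) =
        mapAlgHom (FreeMonoid X) (Algebra.ofId R K) (toAssoc R X (of R x))
      rw [toAssocOver_of, toAssoc_of]
      simp [letter]
    exact fun u => LieHom.congr_fun this u
  refine (injective_iff_map_eq_zero _).2 fun u hu => ?_
  rw [key] at hu
  refine (injective_iff_map_eq_zero _).1 toAssoc_injective u (coeff_injective (Finsupp.ext fun m => h ?_))
  have := congrArg (fun p => coeff p m) hu
  simpa [Algebra.ofId_apply] using this

/-- An element of the subalgebra generated by the last two generators, as an element of the free
associative algebra of rank two. -/
noncomputable def toAssocTwo (R K : Type*) [CommRing R] [Field K] [Algebra R K] :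
    FreeLieAlgebra R (Fin 3) →ₗ⁅R⁆ FreeAssoc K (Fin 2) :=
  FreeLieAlgebra.lift R ![0, letter K 0, letter K 1]

theorem map_eq_eval_toAssocTwo {A : Type*} [Ring A] [Algebra K A] [Algebra R A]
    [IsScalarTower R K A] (F : FreeLieAlgebra R (Fin 3) →ₗ⁅R⁆ A) {h : FreeLieAlgebra R (Fin 3)}
    (hh : h ∈ LieSubalgebra.lieSpan R (FreeLieAlgebra R (Fin 3)) {xg R 1, xg R 2}) :
    F h = eval ![F (xg R 1), F (xg R 2)] (toAssocTwo R K h) := by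
  induction hh using LieSubalgebra.lieSpan_induction with
  | mem u hu =>
    rcases hu with rfl | rfl
    · simp [xg, toAssocTwo]
    · simp [xg, toAssocTwo]
  | zero => simp
  | add u v _ _ hu hv => rw [map_add, hu, hv, map_add, map_add]
  | smul a u _ hu =>
    rw [map_smul, hu, map_smul, ← algebraMap_smul K a (toAssocTwo R K u), map_smul,
      algebraMap_smul]
  | lie u v _ _ hu hv =>
    rw [LieHom.map_lie, hu, hv, LieHom.map_lie, LieRing.of_associative_ring_bracket,
      LieRing.of_associative_ring_bracket, map_sub, map_mul, map_mul]

theorem map_eq_zero_of_mem_derivedSeries {L A : Type*} [LieRing L] [LieAlgebra R L] [CommRing A]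
    [Algebra R A] (F : L →ₗ⁅R⁆ A) {h : L} (hh : h ∈ LieAlgebra.derivedSeries R L 1) : F h = 0 := by
  have : LieAlgebra.derivedSeries R L 1 ≤ F.ker := by
    rw [LieAlgebra.derivedSeries_def, LieAlgebra.derivedSeriesOfIdeal_succ, LieSubmodule.lie_le_iff]
    intro x _ y _
    rw [LieHom.mem_ker, LieHom.map_lie, LieRing.of_associative_ring_bracket, mul_comm, sub_self]
  exact F.mem_ker.1 (this hh)

theorem null_toAssocTwo {h : FreeLieAlgebra R (Fin 3)}
    (hh : h ∈ LieSubalgebra.lieSpan R (FreeLieAlgebra R (Fin 3)) {xg R 1, xg R 2})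
    (hd : h ∈ LieAlgebra.derivedSeries R (FreeLieAlgebra R (Fin 3)) 1) :
    Null (toAssocTwo R K h) := by
  intro r
  have h0 := map_eq_zero_of_mem_derivedSeries (FreeLieAlgebra.lift R ![0, r 0, r 1]) hd
  rw [map_eq_eval_toAssocTwo (K := K) _ hh] at h0
  rw [← h0]
  congr 2
  funext i
  fin_cases i <;> simp [xg]

end FreeLieAlgebra

open FreeLieAlgebra

local notation "L₃" => FreeLieAlgebra R (Fin 3)

theorem lieEquiv_ext_xg {φ ψ : L₃ ≃ₗ⁅R⁆ L₃} (h : ∀ i, φ (xg R i) = ψ (xg R i)) : φ = ψ := by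
  have : (φ : L₃ →ₗ⁅R⁆ L₃) = ψ := FreeLieAlgebra.hom_ext h
  exact LieEquiv.ext fun x => LieHom.congr_fun this x

theorem IsB0Aut.exists_eval (hK : Function.Injective (algebraMap R K)) {τ : L₃ ≃ₗ⁅R⁆ L₃}
    (h : IsB0Aut R τ) (h1 : τ ≠ 1) :
    ∃ p : FreeAssoc K (Fin 2), p ≠ 0 ∧ Null p ∧ τ (xg R 1) = xg R 1 ∧ τ (xg R 2) = xg R 2 ∧
      ∀ F : L₃ →ₗ⁅R⁆ FreeAssoc K (Fin 3),
        F (τ (xg R 0)) = F (xg R 0) + eval ![F (xg R 1), F (xg R 2)] p := by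
  obtain ⟨u, hu, hd, h0, hτ1, hτ2⟩ := h
  refine ⟨toAssocTwo R K u, fun hp => h1 ?_, null_toAssocTwo hu hd, hτ1, hτ2, fun F => ?_⟩
  · have : u = 0 := by
      refine (injective_iff_map_eq_zero _).1 (toAssocOver_injective (K := K) hK (Fin 3)) u ?_
      rw [map_eq_eval_toAssocTwo (K := K) _ hu, hp, map_zero]
    rw [this, add_zero] at h0
    refine lieEquiv_ext_xg fun i => ?_
    fin_cases i
    exacts [h0, hτ1, hτ2]
  · rw [h0, map_add, map_eq_eval_toAssocTwo (K := K) F hu]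

theorem IsLinearAut.exists_matrix {φ : L₃ ≃ₗ⁅R⁆ L₃} (h : IsLinearAut R φ) :
    ∃ S : Fin 3 → Fin 3 → R, ∀ i, φ (xg R i) = S i 0 • xg R 0 + S i 1 • xg R 1 + S i 2 • xg R 2 := by
  choose S hS using fun i => (Submodule.mem_span_range_iff_exists_fun R).1 (h i)
  exact ⟨S, fun i => by rw [← hS i, Fin.sum_univ_three]⟩

theorem IsLinearAut.mul {φ ψ : L₃ ≃ₗ⁅R⁆ L₃} (hφ : IsLinearAut R φ) (hψ : IsLinearAut R ψ) :
    IsLinearAut R (φ * ψ) := by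
  intro i
  obtain ⟨S, hS⟩ := hψ.exists_matrix
  change φ (ψ (xg R i)) ∈ _
  rw [hS, map_add, map_add, map_smul, map_smul, map_smul]
  exact add_mem (add_mem (Submodule.smul_mem _ _ (hφ _)) (Submodule.smul_mem _ _ (hφ _)))
    (Submodule.smul_mem _ _ (hφ _))

/-- The Lie algebra homomorphism to an abelian algebra given by a linear form on the generators. -/
noncomputable def linearForm (c : Fin 3 → R) : L₃ →ₗ⁅R⁆ R :=
  FreeLieAlgebra.lift R c

theorem linearForm_xg (c : Fin 3 → R) (i : Fin 3) : linearForm c (xg R i) = c i := by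
  simp [linearForm, xg]

theorem sum_mul_linearForm (c : Fin 3 → R) (u : L₃) :
    ∑ l, linearForm (Pi.single l 1) u * c l = linearForm c u := by
  let F : L₃ →ₗ⁅R⁆ R :=
    { ∑ l, c l • (linearForm (R := R) (Pi.single l 1) : L₃ →ₗ[R] R) with
      map_lie' := fun {x y} => by
        simp [LieRing.of_associative_ring_bracket, mul_comm] }
  have hF : F = linearForm c := by
    refine FreeLieAlgebra.hom_ext fun i => ?_
    change (∑ l, c l • (linearForm (R := R) (Pi.single l 1) : L₃ →ₗ[R] R)) (xg R i) =
      linearForm c (xg R i)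
    simp [linearForm_xg, Pi.single_apply]
  rw [← hF]
  change _ = (∑ l, c l • (linearForm (R := R) (Pi.single l 1) : L₃ →ₗ[R] R)) u
  simp [mul_comm]

theorem linearForm_comp {φ : L₃ ≃ₗ⁅R⁆ L₃} {S : Fin 3 → Fin 3 → R}
    (hS : ∀ i, φ (xg R i) = S i 0 • xg R 0 + S i 1 • xg R 1 + S i 2 • xg R 2) (j : Fin 3)
    (u : L₃) : linearForm (Pi.single j 1) (φ u) = linearForm (fun i => S i j) u := by
  have : (linearForm (Pi.single j 1)).comp (φ : L₃ →ₗ⁅R⁆ L₃) = linearForm fun i => S i j := by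
    refine FreeLieAlgebra.hom_ext fun i => ?_
    change linearForm (Pi.single j 1) (φ (xg R i)) = linearForm (fun i => S i j) (xg R i)
    rw [hS]
    fin_cases j <;> simp [linearForm_xg]
  exact LieHom.congr_fun this u

theorem isUnit_det_of_lieEquiv {φ : L₃ ≃ₗ⁅R⁆ L₃} {S : Fin 3 → Fin 3 → R}
    (hS : ∀ i, φ (xg R i) = S i 0 • xg R 0 + S i 1 • xg R 1 + S i 2 • xg R 2) :
    IsUnit (Matrix.of S).det := by
  rw [← Matrix.isUnit_iff_isUnit_det]
  refine IsUnit.of_mul_eq_one_right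
    (Matrix.of fun j l => linearForm (Pi.single l 1) (φ.symm (xg R j))) ?_
  ext j i
  simp only [Matrix.mul_apply, Matrix.of_apply]
  rw [sum_mul_linearForm, ← linearForm_comp hS, LieEquiv.apply_symm_apply, linearForm_xg,
    Matrix.one_apply, Pi.single_apply]

theorem isTriangularAut_of_eq_zero {φ : L₃ ≃ₗ⁅R⁆ L₃} {S : Fin 3 → Fin 3 → R}
    (hS : ∀ i, φ (xg R i) = S i 0 • xg R 0 + S i 1 • xg R 1 + S i 2 • xg R 2)
    (h1 : S 1 0 = 0) (h2 : S 2 0 = 0) : IsTriangularAut R φ := by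
  have hdet := isUnit_det_of_lieEquiv hS
  have : (Matrix.of S).det = S 0 0 * (S 1 1 * S 2 2 - S 1 2 * S 2 1) := by
    rw [Matrix.det_fin_three]
    simp [h1, h2]
    ring
  rw [this, IsUnit.mul_iff] at hdet
  refine ⟨S 0 0, S 1 1, S 1 2, S 2 1, S 2 2, S 0 1 • xg R 1 + S 0 2 • xg R 2, hdet.1, hdet.2,
    ?_, ?_, ?_, ?_⟩
  · exact add_mem (LieSubalgebra.smul_mem _ _ (LieSubalgebra.subset_lieSpan (by simp)))
      (LieSubalgebra.smul_mem _ _ (LieSubalgebra.subset_lieSpan (by simp)))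
  · rw [hS, add_assoc]
  · rw [hS, h1, zero_smul, zero_add]
  · rw [hS, h2, zero_smul, zero_add]

theorem IsA0System.not_isTriangularAut {A : Set (L₃ ≃ₗ⁅R⁆ L₃)} (hA : IsA0System R A)
    {σ : L₃ ≃ₗ⁅R⁆ L₃} (hσ : σ ∈ A) (h1 : σ ≠ 1) : ¬ IsTriangularAut R σ := by
  intro h
  exact hA.2.2.2 1 hA.1 σ hσ h1.symm ⟨hA.2.1 σ hσ, h⟩

/-- The images of the generators under an automorphism, in the free associative algebra. -/
noncomputable def images (K : Type*) [Field K] [Algebra R K] (φ : L₃ ≃ₗ⁅R⁆ L₃) (i : Fin 3) :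
    FreeAssoc K (Fin 3) :=
  toAssocOver R K (Fin 3) (φ (xg R i))

theorem images_mul {φ ψ : L₃ ≃ₗ⁅R⁆ L₃} {S : Fin 3 → Fin 3 → R}
    (hS : ∀ i, ψ (xg R i) = S i 0 • xg R 0 + S i 1 • xg R 1 + S i 2 • xg R 2) (i : Fin 3) :
    images K (φ * ψ) i = algebraMap R K (S i 0) • images K φ 0 +
      algebraMap R K (S i 1) • images K φ 1 + algebraMap R K (S i 2) • images K φ 2 := by
  change toAssocOver R K (Fin 3) (φ (ψ (xg R i))) = _
  rw [hS]
  simp only [map_add, map_smul, algebraMap_smul]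
  rfl

theorem images_mul_b0 (hK : Function.Injective (algebraMap R K)) {τ : L₃ ≃ₗ⁅R⁆ L₃}
    (h : IsB0Aut R τ) (h1 : τ ≠ 1) :
    ∃ p : FreeAssoc K (Fin 2), p ≠ 0 ∧ Null p ∧ ∀ φ : L₃ ≃ₗ⁅R⁆ L₃,
      images K (φ * τ) =
        ![images K φ 0 + eval ![images K φ 1, images K φ 2] p, images K φ 1, images K φ 2] := by
  obtain ⟨p, hp, hn, hτ1, hτ2, hF⟩ := h.exists_eval hK h1
  refine ⟨p, hp, hn, fun φ => funext fun i => ?_⟩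
  fin_cases i
  · exact hF ((toAssocOver R K (Fin 3)).comp (φ : L₃ →ₗ⁅R⁆ L₃))
  · change toAssocOver R K (Fin 3) (φ (τ (xg R 1))) = _
    rw [hτ1]
    rfl
  · change toAssocOver R K (Fin 3) (φ (τ (xg R 2))) = _
    rw [hτ2]
    rfl

theorem dominates_images_of_b0 (hK : Function.Injective (algebraMap R K)) {τ : L₃ ≃ₗ⁅R⁆ L₃}
    (h : IsB0Aut R τ) (h1 : τ ≠ 1) : Dominates (images K τ) := by
  obtain ⟨p, hp, hn, hφ⟩ := images_mul_b0 hK h h1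
  have h1τ : images K τ = _ := hφ 1
  rw [h1τ]
  have hl : ∀ i, images K (1 : L₃ ≃ₗ⁅R⁆ L₃) i = letter K i := fun i => toAssocOver_of i
  rw [hl, hl, hl]
  exact Dominates.base (by decide) hp hn

theorem FreeAssoc.Dominates.images_mul_mul [IsDomain R] (hK : Function.Injective (algebraMap R K))
    {φ σ τ : L₃ ≃ₗ⁅R⁆ L₃} (hφ : Dominates (images K φ)) (hσ : IsLinearAut R σ)
    (hσ' : ¬ IsTriangularAut R σ) (hτ : IsB0Aut R τ) (h1 : τ ≠ 1) :
    Dominates (images K (φ * (σ * τ))) := by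
  obtain ⟨p, hp, hn, hpφ⟩ := images_mul_b0 hK hτ h1
  obtain ⟨S, hS⟩ := hσ.exists_matrix
  rw [← mul_assoc, hpφ]
  have hS0 : S 2 0 ≠ 0 ∨ S 1 0 ≠ 0 := by
    by_contra! h
    exact hσ' (isTriangularAut_of_eq_zero hS h.2 h.1)
  have hmap : ∀ a : R, a ≠ 0 → algebraMap R K a ≠ 0 := fun a ha =>
    (map_ne_zero_iff _ hK).2 ha
  refine hφ.step (S := fun i j => algebraMap R K (S i j)) (images_mul hS)
    (hS0.imp (hmap _) (hmap _)) ?_ hp hn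
  simp only [← map_mul, ← map_sub]
  refine Or.imp (hmap _) (hmap _) ?_
  by_contra! h
  have h0 : σ (S 2 0 • xg R 1 - S 1 0 • xg R 2) = 0 := by
    rw [map_sub, map_smul, map_smul, hS, hS]
    have : S 2 0 • (S 1 0 • xg R 0 + S 1 1 • xg R 1 + S 1 2 • xg R 2) -
        S 1 0 • (S 2 0 • xg R 0 + S 2 1 • xg R 1 + S 2 2 • xg R 2) =
        (S 2 0 * S 1 1 - S 1 0 * S 2 1) • xg R 1 + (S 2 0 * S 1 2 - S 1 0 * S 2 2) • xg R 2 := by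
      module
    rw [this, h.1, h.2, zero_smul, zero_smul, add_zero]
  have h0' : S 2 0 • xg R 1 - S 1 0 • xg R 2 = 0 := σ.injective (h0.trans (map_zero σ).symm)
  have e1 := congrArg (linearForm (Pi.single 1 1)) h0'
  have e2 := congrArg (linearForm (Pi.single 2 1)) h0'
  simp [linearForm_xg] at e1 e2
  exact hS0.elim (· e1) (· e2)

theorem FreeAssoc.Dominates.mul_ne_one [Nontrivial R] (hK : Function.Injective (algebraMap R K))
    {φ μ : L₃ ≃ₗ⁅R⁆ L₃} (hφ : Dominates (images K φ)) (hμ : IsLinearAut R μ) : φ * μ ≠ 1 := by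
  intro h
  obtain ⟨S, hS⟩ := hμ.exists_matrix
  have h0 : ∀ i, S i 0 = 0 := fun i => by
    have := images_mul (K := K) (φ := φ) hS i
    rw [h] at this
    exact (map_eq_zero_iff _ hK).1
      (hφ.eq_zero_of_eq_letter (this.symm.trans (toAssocOver_of i)))
  have hdet := isUnit_det_of_lieEquiv hS
  rw [Matrix.det_fin_three] at hdet
  simp [h0] at hdet

theorem exists_dominates_prod [IsDomain R] (hK : Function.Injective (algebraMap R K))
    {A : Set (L₃ ≃ₗ⁅R⁆ L₃)} (hA : IsA0System R A) {σ τ : ℕ → (L₃ ≃ₗ⁅R⁆ L₃)} (k : ℕ)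
    (hσ : ∀ j, 1 ≤ j → j < k + 1 → σ j ∈ A ∧ σ j ≠ 1)
    (hτ : ∀ j < k + 1, IsB0Aut R (τ j) ∧ τ j ≠ 1) :
    ∃ φ, ((List.range (k + 1)).map fun j => σ j * τ j).prod = σ 0 * φ ∧
      Dominates (images K φ) := by
  induction k with
  | zero => exact ⟨τ 0, mul_one _, dominates_images_of_b0 hK (hτ 0 (by simp)).1 (hτ 0 (by simp)).2⟩
  | succ k ih =>
    obtain ⟨φ, h1, h2⟩ := ih (fun j hj hjk => hσ j hj (by omega)) fun j hj => hτ j (by omega)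
    have hk := hσ (k + 1) (by omega) (by omega)
    have hk' := hτ (k + 1) (by omega)
    refine ⟨φ * (σ (k + 1) * τ (k + 1)), ?_, h2.images_mul_mul hK (hA.2.1 _ hk.1)
      (hA.not_isTriangularAut hk.1 hk.2) hk'.1 hk'.2⟩
    rw [List.range_succ, List.map_append, List.prod_append, h1, List.map_singleton,
      List.prod_singleton, mul_assoc]

end Automorphisms

/-- Uniqueness of the normal form of tame automorphisms of `L_3(Φ)`: no product
`σ₁ ∘ τ₁ ∘ σ₂ ∘ τ₂ ∘ ⋯ ∘ σ_k ∘ τ_k ∘ σ_{k+1} ∘ λ` with `k ≥ 1`, `σ_i ∈ A₀`,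
`σ₂, …, σ_k ≠ id`, `id ≠ τ_i ∈ B₀` and `λ ∈ GL₃(Φ)` equals the identity
automorphism.  (Indices are shifted down by one: `σ j` here is `σ_{j+1}`.) -/
theorem normal_form_unique
    (Φ : Type*) [CommRing Φ] [IsDomain Φ]
    (A0 : Set (FreeLieAlgebra Φ (Fin 3) ≃ₗ⁅Φ⁆ FreeLieAlgebra Φ (Fin 3)))
    (hA0 : IsA0System Φ A0) (k : ℕ) (hk : 1 ≤ k)
    (σ τ : ℕ → (FreeLieAlgebra Φ (Fin 3) ≃ₗ⁅Φ⁆ FreeLieAlgebra Φ (Fin 3)))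
    (lam : FreeLieAlgebra Φ (Fin 3) ≃ₗ⁅Φ⁆ FreeLieAlgebra Φ (Fin 3))
    (hσ : ∀ j ≤ k, σ j ∈ A0) (hσ' : ∀ j, 1 ≤ j → j < k → σ j ≠ 1)
    (hτ : ∀ j < k, IsB0Aut Φ (τ j) ∧ τ j ≠ 1)
    (hlam : IsLinearAut Φ lam) :
    ((List.range k).map (fun j => σ j * τ j)).prod * σ k * lam ≠ 1 := by
  obtain ⟨k, rfl⟩ : ∃ m, k = m + 1 := ⟨k - 1, by omega⟩
  have hK : Function.Injective (algebraMap Φ (FractionRing Φ)) :=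
    IsFractionRing.injective Φ (FractionRing Φ)
  obtain ⟨φ, h1, h2⟩ := exists_dominates_prod hK hA0 k
    (fun j hj hjk => ⟨hσ j hjk.le, hσ' j hj hjk⟩) hτ
  have hlin := hA0.2.1
  intro h
  rw [h1, mul_assoc, mul_assoc] at h
  refine h2.mul_ne_one hK (((hlin _ (hσ (k + 1) le_rfl)).mul hlam).mul (hlin _ (hσ 0 (by omega)))) ?_
  rw [← mul_assoc]
  exact mul_eq_one_comm.1 h
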